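/- arXiv:2007.11051 — 4 statements merged into one kernel-verified Lean document; each statement's English description precedes it below -/
import Mathlib

section
/- Let G be a connected simple graph on [N]. Then the normalized volume of the PQ-type adjacency polytope ∇^PQ_G equals the number of D(G)-draconian sequences. Concretely: (2N−2)! times the (2N−2)-dimensional Lebesgue measure of the image of ∇^PQ_G under the coordinate projection (x_1,…,x_{2N}) ↦ (x_2,…,x_N, x_{N+2},…,x_{2N}) (which is a lattice-preserving bijection on ∇^PQ_G) equals |𝔇(G)|. -/
open Finset

attribute [local instance] Classical.propDecidable

/-- The set of neighbors of `i` in `G`, as a `Finset`. -/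
noncomputable def nbr {N : ℕ} (G : SimpleGraph (Fin N)) (i : Fin N) : Finset (Fin N) :=
  Finset.univ.filter (fun j => G.Adj i j)

/-- `(a 1, …, a N)` is a `D(G)`-draconian sequence: the entries sum to `N - 1` and for
every nonempty `S ⊆ [N]` one has `∑_{i ∈ S} a i < |S ∪ ⋃_{i ∈ S} N_G(i)|`. -/
def draconian {N : ℕ} (G : SimpleGraph (Fin N)) (a : Fin N → ℕ) : Prop :=
  (∑ i, a i) = N - 1 ∧
  ∀ S : Finset (Fin N), S.Nonempty →
    (∑ i ∈ S, a i) < (S ∪ S.biUnion (fun i => nbr G i)).card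

open MeasureTheory

/-- The vertex `(e_i, e_j) ∈ ℝ^N × ℝ^N = ℝ^{2N}` of the PQ-type adjacency polytope. -/
def pqVertex (N : ℕ) (i j : Fin N) : Fin (2 * N) → ℝ :=
  fun k => (if (k : ℕ) = (i : ℕ) then 1 else 0) + (if (k : ℕ) = N + (j : ℕ) then 1 else 0)

/-- The PQ-type adjacency polytope
`∇^PQ_G = conv{(e_i, e_j) ∈ ℝ^N × ℝ^N : ij ∈ E(G) or i = j}`. -/
def adjPolytopePQ {N : ℕ} (G : SimpleGraph (Fin N)) : Set (Fin (2 * N) → ℝ) :=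
  convexHull ℝ {x | ∃ i j : Fin N, (i = j ∨ G.Adj i j) ∧ x = pqVertex N i j}

/-- The inclusion `Fin (2N - 2) → Fin (2N)` realizing the coordinate projection
`(x_1, …, x_{2N}) ↦ (x_2, …, x_N, x_{N+2}, …, x_{2N})` (deleting coordinates `1` and
`N + 1`). -/
def projEmb (N : ℕ) (k : Fin (2 * N - 2)) : Fin (2 * N) :=
  if _ : (k : ℕ) < N - 1 then ⟨(k : ℕ) + 1, by have := k.isLt; omega⟩
  else ⟨(k : ℕ) + 2, by have := k.isLt; omega⟩


/-- The open corner simplex `{x | 0 < x i, ∑ x i < 1}` in `ℝⁿ`. -/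
def openCorner (n : ℕ) : Set (Fin n → ℝ) := {x | (∀ i, 0 < x i) ∧ ∑ i, x i < 1}

theorem isOpen_openCorner (n : ℕ) : IsOpen (openCorner n) := by
  have h : openCorner n = (⋂ i, {x : Fin n → ℝ | 0 < x i}) ∩ {x | ∑ i, x i < 1} := by
    ext x; simp [openCorner]
  rw [h]
  exact (isOpen_iInter_of_finite fun i => isOpen_lt continuous_const (continuous_apply i)).inter
    (isOpen_lt (by fun_prop) continuous_const)

theorem measurePreserving_units_mul {n : ℕ} (s : Fin n → ℤˣ) :
    MeasurePreserving (fun (x : Fin n → ℝ) i => ((s i : ℤ) : ℝ) * x i) := by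
  refine volume_preserving_pi (f := fun i (t : ℝ) => ((s i : ℤ) : ℝ) * t) fun i => ?_
  rcases Int.units_eq_one_or (s i) with h | h
  · simpa [h, Function.id_def] using MeasurePreserving.id (volume : Measure ℝ)
  · simpa [h] using Measure.measurePreserving_neg (volume : Measure ℝ)

theorem factorial_mul_volume_openCorner (n : ℕ) :
    (n.factorial : ENNReal) * volume (openCorner n) = 1 := by
  set C : (Fin n → ℤˣ) → Set (Fin n → ℝ) :=
    fun s => (fun (x : Fin n → ℝ) i => ((s i : ℤ) : ℝ) * x i) ⁻¹' openCorner n with hC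
  have hvol (s) : volume (C s) = volume (openCorner n) :=
    (measurePreserving_units_mul s).measure_preimage
      (isOpen_openCorner n).measurableSet.nullMeasurableSet
  have hmeas (s) : MeasurableSet (C s) :=
    (measurePreserving_units_mul s).measurable (isOpen_openCorner n).measurableSet
  have habs (s) (x) (hx : x ∈ C s) (i) : ((s i : ℤ) : ℝ) * x i = |x i| := by
    have h := hx.1 i
    rcases Int.units_eq_one_or (s i) with h' | h' <;> simp [h'] at h ⊢
    · rw [abs_of_pos h]
    · rw [abs_of_neg h]
  have hdisj : ((univ : Finset (Fin n → ℤˣ)) : Set (Fin n → ℤˣ)).PairwiseDisjoint C := by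
    intro s _ t _ hst
    refine Set.disjoint_left.mpr fun x hx hx' => hst (funext fun i => ?_)
    have h := (habs s x hx i).trans (habs t x hx' i).symm
    have h0 : x i ≠ 0 := by
      intro h0
      have := hx.1 i
      simp [h0] at this
    exact_mod_cast mul_right_cancel₀ h0 h
  have hunion : (⋃ s ∈ (univ : Finset (Fin n → ℤˣ)), C s)
      =ᵐ[volume] {x : Fin n → ℝ | ∑ i, |x i| ^ (1 : ℝ) < 1} := by
    have hne : ∀ᵐ x : Fin n → ℝ, ∀ i, x i ≠ 0 := by
      refine ae_all_iff.mpr fun i => ?_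
      rw [ae_iff]
      simpa [volume_pi] using Measure.pi_hyperplane (fun _ : Fin n => (volume : Measure ℝ)) i 0
    filter_upwards [hne] with x hx
    refine propext ⟨fun h => ?_, fun h => ?_⟩
    · obtain ⟨s, hs⟩ : ∃ s, x ∈ C s := by simpa using (show x ∈ ⋃ s ∈ _, C s from h)
      have := hs.2
      simp only [habs s x hs] at this
      show ∑ i, |x i| ^ (1 : ℝ) < 1
      simpa using this
    · have h' : ∑ i, |x i| < 1 := by simpa using (show ∑ i, |x i| ^ (1 : ℝ) < 1 from h)
      have key (i) : (((if 0 < x i then 1 else -1 : ℤˣ) : ℤ) : ℝ) * x i = |x i| := by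
        split_ifs with hi
        · simp [abs_of_pos hi]
        · simp [abs_of_nonpos (not_lt.mp hi)]
      suffices x ∈ ⋃ s ∈ (univ : Finset (Fin n → ℤˣ)), C s from this
      simp only [Finset.mem_univ, Set.iUnion_true, Set.mem_iUnion]
      refine ⟨fun i => if 0 < x i then 1 else -1, ?_, ?_⟩
      · intro i
        simp only [key]
        exact abs_pos.mpr (hx i)
      · simpa only [key] using h'
  have htot := measure_congr hunion
  rw [measure_biUnion_finset hdisj fun s _ => hmeas s, volume_sum_rpow_lt_one _ le_rfl] at htot
  simp only [hvol, sum_const, Finset.card_univ, Fintype.card_pi, Fintype.card_units_int,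
    prod_const, Fintype.card_fin, nsmul_eq_mul, div_one, one_add_one_eq_two,
    Real.Gamma_two, mul_one, Real.Gamma_nat_eq_factorial] at htot
  rw [ENNReal.ofReal_div_of_pos (by positivity), ENNReal.ofReal_pow (by norm_num),
    ENNReal.ofReal_natCast, ENNReal.ofReal_ofNat] at htot
  have h2 : ((2 : ENNReal) ^ n) ≠ 0 := by positivity
  have h2' : ((2 : ENNReal) ^ n) ≠ ⊤ := by finiteness
  have hf : (n.factorial : ENNReal) ≠ 0 := by exact_mod_cast n.factorial_ne_zero
  push_cast at htot
  rw [div_eq_mul_inv, ENNReal.mul_right_inj h2 h2'] at htot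
  rw [htot, ENNReal.mul_inv_cancel hf (by finiteness)]

section Triangulation

variable {ι κ : Type*} [Fintype ι]

/-- The nonnegative combinations of the family `v`. -/
def posCone (v : ι → κ → ℝ) : Set (κ → ℝ) :=
  {p | ∃ f : ι → ℝ, (∀ e, 0 ≤ f e) ∧ ∑ e, f e • v e = p}

/-- The combinations of the family `v` whose coefficients are positive on `T` and vanish off `T`. -/
def openCone (v : ι → κ → ℝ) (T : Finset ι) : Set (κ → ℝ) :=
  {p | ∃ f : ι → ℝ, (∀ e ∈ T, 0 < f e) ∧ (∀ e ∉ T, f e = 0) ∧ ∑ e, f e • v e = p}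

/-- `T` indexes a basis of the span of the family `v`. -/
def IsSpanBasis (v : ι → κ → ℝ) (T : Finset ι) : Prop :=
  LinearIndepOn ℝ v (T : Set ι) ∧ ∀ e, v e ∈ Submodule.span ℝ (Set.image v T)

/-- `T` is the set of tight constraints of a dual feasible functional for the weights `w`. -/
def IsTightSet (v : ι → κ → ℝ) (w : ι → ℝ) (T : Finset ι) : Prop :=
  ∃ u : (κ → ℝ) →ₗ[ℝ] ℝ, (∀ e ∈ T, u (v e) = w e) ∧ ∀ e ∉ T, u (v e) < w e

/-- The cells of the regular triangulation of the family `v` induced by the weights `w`. -/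
noncomputable def regularCells (v : ι → κ → ℝ) (w : ι → ℝ) : Finset (Finset ι) :=
  univ.filter fun T => IsSpanBasis v T ∧ IsTightSet v w T

/-- Weights for which no functional is tight on more elements than a basis. -/
def IsGenericWeight (v : ι → κ → ℝ) (w : ι → ℝ) : Prop :=
  ∀ T, IsSpanBasis v T → ∀ u : (κ → ℝ) →ₗ[ℝ] ℝ, (∀ e ∈ T, u (v e) = w e) →
    ∀ e ∉ T, u (v e) ≠ w e

/-- `p` lies in no proper subspace spanned by members of the family `v`. -/
def IsSpanGeneric (v : ι → κ → ℝ) (p : κ → ℝ) : Prop :=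
  ∀ S : Finset ι, p ∈ Submodule.span ℝ (v '' S) → ∀ e, v e ∈ Submodule.span ℝ (v '' S)

variable {v : ι → κ → ℝ} {w : ι → ℝ} {T T' : Finset ι} {p : κ → ℝ}

theorem openCone_subset_posCone : openCone v T ⊆ posCone v := by
  rintro p ⟨f, h1, h2, h3⟩
  refine ⟨f, fun e => ?_, h3⟩
  by_cases he : e ∈ T
  · exact (h1 e he).le
  · exact (h2 e he).ge

theorem IsTightSet.subset (hT : IsTightSet v w T) (hT' : IsTightSet v w T')
    (h : p ∈ openCone v T) (h' : p ∈ openCone v T') : T' ⊆ T := by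
  obtain ⟨u, hu, hu'⟩ := hT
  obtain ⟨u', hu₂, hu₂'⟩ := hT'
  obtain ⟨f, hf1, hf2, hf3⟩ := h
  obtain ⟨g, hg1, hg2, hg3⟩ := h'
  have e1 : u p = ∑ e, f e * w e := by
    rw [← hf3, map_sum]
    refine sum_congr rfl fun e _ => ?_
    by_cases he : e ∈ T
    · simp [hu e he]
    · simp [hf2 e he]
  have e2 : u' p = ∑ e, g e * w e := by
    rw [← hg3, map_sum]
    refine sum_congr rfl fun e _ => ?_
    by_cases he : e ∈ T'
    · simp [hu₂ e he]
    · simp [hg2 e he]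
  have l1 : u' p ≤ ∑ e, f e * w e := by
    rw [← hf3, map_sum]
    refine sum_le_sum fun e _ => ?_
    by_cases he : e ∈ T
    · rw [map_smul, smul_eq_mul]
      refine mul_le_mul_of_nonneg_left ?_ (hf1 e he).le
      by_cases he' : e ∈ T'
      · exact (hu₂ e he').le
      · exact (hu₂' e he').le
    · simp [hf2 e he]
  intro a ha
  by_contra haT
  have l2 : u p < ∑ e, g e * w e := by
    rw [← hg3, map_sum]
    refine sum_lt_sum (fun e _ => ?_) ⟨a, mem_univ a, ?_⟩
    · by_cases he : e ∈ T'
      · rw [map_smul, smul_eq_mul]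
        refine mul_le_mul_of_nonneg_left ?_ (hg1 e he).le
        by_cases he' : e ∈ T
        · exact (hu e he').le
        · exact (hu' e he').le
      · simp [hg2 e he]
    · rw [map_smul, smul_eq_mul]
      exact mul_lt_mul_of_pos_left (hu' a haT) (hg1 a ha)
  linarith

theorem IsTightSet.eq (hT : IsTightSet v w T) (hT' : IsTightSet v w T')
    (h : p ∈ openCone v T) (h' : p ∈ openCone v T') : T = T' :=
  (hT'.subset hT h' h).antisymm (hT.subset hT' h h')

theorem exists_isGenericWeight (v : ι → κ → ℝ) : ∃ w, IsGenericWeight v w := by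
  let X := {x : Finset ι × ι // IsSpanBasis v x.1 ∧ x.2 ∉ x.1}
  have hc (x : X) : ∃ c : ι → ℝ, ∑ t ∈ x.1.1, c t • v t = v x.1.2 := by
    obtain ⟨c, hc⟩ := (Submodule.mem_span_image_finset_iff_exists_fun ℝ).mp (x.2.1.2 x.1.2)
    refine ⟨fun t => if h : t ∈ x.1.1 then c ⟨t, h⟩ else 0, ?_⟩
    rw [← hc, ← sum_coe_sort]
    exact sum_congr rfl fun t _ => by simp
  choose c hc using hc
  let F (x : X) : Module.Dual ℝ (ι → ℝ) :=
    LinearMap.proj x.1.2 - ∑ t ∈ x.1.1, c x t • LinearMap.proj t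
  obtain ⟨w, hw⟩ := Module.Dual.exists_forall_ne_zero_of_forall_exists F (fun x =>
    ⟨Pi.single x.1.2 1, by
      have : ∀ t ∈ x.1.1, c x t * (Pi.single x.1.2 1 : ι → ℝ) t = 0 := fun t ht => by
        rw [Pi.single_eq_of_ne fun h => x.2.2 (by rwa [← h]), mul_zero]
      simp [F, sum_eq_zero this]⟩)
  refine ⟨w, fun T hT u hu e he h => hw ⟨(T, e), hT, he⟩ ?_⟩
  have h2 := hc ⟨(T, e), hT, he⟩
  simp only at h2
  rw [← h2, map_sum] at h
  simp only [F, LinearMap.sub_apply, LinearMap.proj_apply, LinearMap.sum_apply,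
    LinearMap.smul_apply, smul_eq_mul]
  rw [← h, sub_eq_zero]
  exact sum_congr rfl fun t ht => by simp [hu t ht]

theorem exists_pos_forall_add_mul_nonneg (f c : ι → ℝ) (hf : ∀ e, 0 ≤ f e)
    (hc : ∀ e, c e < 0 → 0 < f e) : ∃ ε > 0, ∀ e, 0 ≤ f e + ε * c e := by
  have h (e : ι) : ∀ᶠ ε in nhdsWithin (0 : ℝ) (Set.Ioi 0), 0 ≤ f e + ε * c e := by
    by_cases he : c e < 0
    · have h1 : Filter.Tendsto (fun ε : ℝ => f e + ε * c e) (nhdsWithin 0 (Set.Ioi 0))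
          (nhds (f e + 0 * c e)) :=
        ((continuous_const.add (continuous_id.mul continuous_const)).tendsto 0).mono_left
          nhdsWithin_le_nhds
      have h2 : 0 < f e + 0 * c e := by simpa using hc e he
      exact (h1.eventually (lt_mem_nhds h2)).mono fun _ h => h.le
    · filter_upwards [self_mem_nhdsWithin] with ε hε
      exact add_nonneg (hf e) (mul_nonneg (le_of_lt hε) (not_lt.mp he))
  obtain ⟨ε, h1, h2⟩ := ((Filter.eventually_all.mpr h).and self_mem_nhdsWithin).exists
  exact ⟨ε, h2, h1⟩

omit [Fintype ι] in
theorem IsSpanBasis.exists_functional (hT : IsSpanBasis v T) (w : ι → ℝ) :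
    ∃ u : (κ → ℝ) →ₗ[ℝ] ℝ, ∀ e ∈ T, u (v e) = w e := by
  obtain ⟨u, hu⟩ := LinearMap.exists_extend ((Module.Basis.span hT.1.linearIndependent).constr ℝ
    (fun e : (T : Set ι) => w e))
  refine ⟨u, fun e he => ?_⟩
  have h1 := (Module.Basis.span hT.1.linearIndependent).constr_basis ℝ
    (fun e : (T : Set ι) => w e) ⟨e, he⟩
  rw [← hu] at h1
  simpa [Module.Basis.span_apply] using h1

/-- Every generic point of the cone over `v` lies in an open cell of the triangulation. -/
theorem exists_mem_regularCells_mem_openCone [Finite κ] (hw : IsGenericWeight v w)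
    (ℓ : (κ → ℝ) →ₗ[ℝ] ℝ) (hℓ : ∀ e, ℓ (v e) = 1)
    (hp : IsSpanGeneric v p) (hpc : p ∈ posCone v) :
    ∃ T ∈ regularCells v w, p ∈ openCone v T := by
  have := Fintype.ofFinite κ
  set K : Set (ι → ℝ) := {f | (∀ e, 0 ≤ f e) ∧ ∑ e, f e • v e = p} with hK
  have hKclosed : IsClosed K := by
    have : K = (⋂ e, {f : ι → ℝ | 0 ≤ f e}) ∩ {f | ∑ e, f e • v e = p} := by
      ext f; simp [hK]
    rw [this]
    exact (isClosed_iInter fun e => isClosed_le continuous_const (continuous_apply e)).inter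
      (isClosed_eq (by fun_prop) continuous_const)
  have hKcompact : IsCompact K := by
    refine (isCompact_Icc (a := (0 : ι → ℝ)) (b := fun _ => ℓ p)).of_isClosed_subset hKclosed ?_
    rintro f ⟨h1, h2⟩
    refine ⟨h1, fun e => ?_⟩
    have : ℓ p = ∑ e, f e := by simp [← h2, hℓ]
    rw [this]
    exact single_le_sum (fun e _ => h1 e) (mem_univ e)
  obtain ⟨f₀, hf₀, hmin₀⟩ := hKcompact.exists_isMinOn hpc
    (f := fun f => ∑ e, f e * w e) (by fun_prop)
  set K' : Set (ι → ℝ) := K ∩ {f | ∑ e, f e * w e = ∑ e, f₀ e * w e} with hK'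
  have hK'compact : IsCompact K' :=
    hKcompact.inter_right (isClosed_eq (by fun_prop) continuous_const)
  obtain ⟨f, ⟨hf, hfw⟩, hmax⟩ := hK'compact.exists_isMaxOn ⟨f₀, hf₀, rfl⟩
    (f := fun f => ∑ e, f e ^ 2) (by fun_prop)
  have hmin (g) (hg : g ∈ K) : ∑ e, f e * w e ≤ ∑ e, g e * w e :=
    (show ∑ e, f e * w e = _ from hfw).le.trans (hmin₀ hg)
  set T : Finset ι := univ.filter fun e => f e ≠ 0 with hTdef
  have hTpos : ∀ e ∈ T, 0 < f e := fun e he => (hf.1 e).lt_of_ne' (mem_filter.mp he).2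
  have hTzero : ∀ e ∉ T, f e = 0 := fun e he => by simpa [hTdef] using he
  have hpert (c : ι → ℝ) (hc : ∑ e, c e • v e = 0) (ε : ℝ)
      (h : ∀ e, 0 ≤ f e + ε * c e) : (fun e => f e + ε * c e) ∈ K := by
    refine ⟨h, ?_⟩
    simp only [add_smul, sum_add_distrib, mul_smul, ← smul_sum, hc, hf.2, smul_zero, add_zero]
  have hsumT (c : ι → ℝ) (hc : ∀ e ∉ T, c e = 0) : ∑ e, c e • v e = ∑ e ∈ T, c e • v e :=
    (sum_subset (subset_univ T) fun e _ he => by simp [hc e he]).symm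
  have hindep : LinearIndepOn ℝ v (T : Set ι) := by
    rw [linearIndepOn_finset_iff]
    intro c' hc' e he
    by_contra hne
    set c : ι → ℝ := fun e => if e ∈ T then c' e else 0 with hcdef
    have hc0 : ∑ e, c e • v e = 0 := by
      rw [hsumT c (fun e he => by simp [hcdef, he]), ← hc']
      exact sum_congr rfl fun e he => by simp [hcdef, he]
    obtain ⟨ε, hε, hεf⟩ := exists_pos_forall_add_mul_nonneg f (fun e => -|c e|) hf.1 (by
      intro e he
      by_cases heT : e ∈ T
      · exact hTpos e heT
      · simp [hcdef, heT] at he)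
    have b1 (e) : 0 ≤ f e + ε * c e := by
      nlinarith [hεf e, neg_abs_le (c e), mul_le_mul_of_nonneg_left (neg_abs_le (c e)) hε.le]
    have b2 (e) : 0 ≤ f e + (-ε) * c e := by
      nlinarith [hεf e, mul_le_mul_of_nonneg_left (le_abs_self (c e)) hε.le]
    have k1 := hpert c hc0 ε b1
    have k2 := hpert c hc0 (-ε) b2
    have m1 := hmin _ k1
    have m2 := hmin _ k2
    simp only [add_mul, sum_add_distrib, mul_assoc, ← mul_sum] at m1 m2
    have hcw : ε * ∑ e, c e * w e = 0 := by linarith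
    have n1 := hmax (show (fun e => f e + ε * c e) ∈ K' from ⟨k1, by
      simp only [Set.mem_ofPred_eq, add_mul, sum_add_distrib, mul_assoc, ← mul_sum]
      linarith [show ∑ e, f e * w e = _ from hfw]⟩)
    have n2 := hmax (show (fun e => f e + (-ε) * c e) ∈ K' from ⟨k2, by
      simp only [Set.mem_ofPred_eq, add_mul, sum_add_distrib, mul_assoc, ← mul_sum]
      linarith [show ∑ e, f e * w e = _ from hfw]⟩)
    simp only [Set.mem_ofPred_eq] at n1 n2
    have hpos : 0 < ∑ e, c e ^ 2 :=
      sum_pos' (fun e _ => sq_nonneg _) ⟨e, mem_univ e, by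
        have : c e ≠ 0 := by simpa [hcdef, he] using hne
        positivity⟩
    have hsq : ∑ e, (f e + ε * c e) ^ 2 + ∑ e, (f e + (-ε) * c e) ^ 2
        = 2 * ∑ e, f e ^ 2 + 2 * ε ^ 2 * ∑ e, c e ^ 2 := by
      rw [← sum_add_distrib, mul_sum, mul_sum, ← sum_add_distrib]
      exact sum_congr rfl fun e _ => by ring
    have : 0 < 2 * ε ^ 2 * ∑ e, c e ^ 2 := by positivity
    linarith
  have hpT : p ∈ Submodule.span ℝ (v '' T) := by
    rw [← hf.2, hsumT f hTzero]
    exact Submodule.sum_mem _ fun e he =>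
      Submodule.smul_mem _ _ (Submodule.subset_span (Set.mem_image_of_mem v he))
  have hbasis : IsSpanBasis v T := ⟨hindep, hp T hpT⟩
  obtain ⟨u, hu⟩ := hbasis.exists_functional w
  refine ⟨T, mem_filter.mpr ⟨mem_univ _, hbasis, u, hu, fun a ha => ?_⟩, f, hTpos, hTzero, hf.2⟩
  refine lt_of_le_of_ne ?_ (hw T hbasis u hu a ha)
  obtain ⟨c', hc'⟩ := (Submodule.mem_span_image_finset_iff_exists_fun ℝ).mp (hbasis.2 a)
  set b : ι → ℝ := fun t => if h : t ∈ T then c' ⟨t, h⟩ else 0 with hb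
  have hb0 : ∀ e ∉ T, b e = 0 := fun e he => by simp [hb, he]
  have hbv : ∑ e, b e • v e = v a := by
    rw [hsumT b hb0, ← hc', ← sum_coe_sort]
    exact sum_congr rfl fun t _ => by simp [hb]
  have hsingle : ∑ e, (Pi.single a 1 : ι → ℝ) e • v e = v a := by
    rw [sum_eq_single a] <;> simp +contextual
  set c : ι → ℝ := fun e => (Pi.single a 1 : ι → ℝ) e - b e with hcdef
  have hc0 : ∑ e, c e • v e = 0 := by
    simp only [hcdef, sub_smul, sum_sub_distrib, hbv, hsingle, sub_self]
  obtain ⟨ε, hε, hεf⟩ := exists_pos_forall_add_mul_nonneg f c hf.1 (by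
    intro e he
    by_cases heT : e ∈ T
    · exact hTpos e heT
    · have : 0 ≤ c e := by
        simp only [hcdef, hb0 e heT, sub_zero, Pi.single_apply]
        split_ifs <;> norm_num
      linarith)
  have m := hmin _ (hpert c hc0 ε hεf)
  simp only [add_mul, sum_add_distrib, mul_assoc, ← mul_sum] at m
  have hcw : 0 ≤ ∑ e, c e * w e := by
    by_contra! hneg
    nlinarith [mul_neg_of_pos_of_neg hε hneg]
  have huva : u (v a) = ∑ e, b e * w e := by
    rw [← hbv, map_sum]
    refine sum_congr rfl fun e _ => ?_
    by_cases he : e ∈ T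
    · simp [hu e he]
    · simp [hb0 e he]
  have hcw' : ∑ e, c e * w e = w a - ∑ e, b e * w e := by
    simp only [hcdef, sub_mul, sum_sub_distrib]
    congr 1
    rw [sum_eq_single a] <;> simp +contextual
  linarith

end Triangulation

section EdgeVectors

variable {N : ℕ}

/-- The vertex `(e_i, e_j)`, with coordinates indexed by two copies of `Fin N`. -/
noncomputable def edgeVec (e : Fin N × Fin N) : Fin N ⊕ Fin N → ℝ :=
  Pi.single (Sum.inl e.1) 1 + Pi.single (Sum.inr e.2) 1

/-- The edges of the bipartite graph `D(G)`. -/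
abbrev BiEdge (G : SimpleGraph (Fin N)) := {e : Fin N × Fin N // e.1 = e.2 ∨ G.Adj e.1 e.2}

/-- The vertices of the adjacency polytope, indexed by the edges of `D(G)`. -/
noncomputable def biVec (G : SimpleGraph (Fin N)) (e : BiEdge G) : Fin N ⊕ Fin N → ℝ :=
  edgeVec e.1

/-- The difference of the left mass on `A` and the right mass on `B`. -/
noncomputable def cutForm (A B : Finset (Fin N)) : (Fin N ⊕ Fin N → ℝ) →ₗ[ℝ] ℝ :=
  ∑ i ∈ A, LinearMap.proj (Sum.inl i) - ∑ j ∈ B, LinearMap.proj (Sum.inr j)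

theorem cutForm_apply (A B : Finset (Fin N)) (p : Fin N ⊕ Fin N → ℝ) :
    cutForm A B p = ∑ i ∈ A, p (Sum.inl i) - ∑ j ∈ B, p (Sum.inr j) := by
  simp [cutForm]

theorem cutForm_edgeVec (A B : Finset (Fin N)) (e : Fin N × Fin N) :
    cutForm A B (edgeVec e) = (if e.1 ∈ A then 1 else 0) - (if e.2 ∈ B then 1 else 0) := by
  simp [cutForm_apply, edgeVec, Pi.single_apply]

theorem apply_edgeVec (u : (Fin N ⊕ Fin N → ℝ) →ₗ[ℝ] ℝ) (e : Fin N × Fin N) :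
    u (edgeVec e) = u (Pi.single (Sum.inl e.1) 1) + u (Pi.single (Sum.inr e.2) 1) := by
  rw [edgeVec, map_add]

variable {G : SimpleGraph (Fin N)} {T : Finset (BiEdge G)}

theorem exists_cut_of_notMem_span {S : Set (BiEdge G)} {e : BiEdge G}
    (h : biVec G e ∉ Submodule.span ℝ (biVec G '' S)) :
    ∃ A B : Finset (Fin N), e.1.1 ∈ A ∧ e.1.2 ∉ B ∧ ∀ e' ∈ S, (e'.1.1 ∈ A ↔ e'.1.2 ∈ B) := by
  obtain ⟨u, hu, hS⟩ := Submodule.exists_le_ker_of_notMem h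
  rw [Submodule.span_le] at hS
  set c := u (Pi.single (Sum.inl e.1.1) 1)
  refine ⟨univ.filter fun i => u (Pi.single (Sum.inl i) 1) = c,
    univ.filter fun j => u (Pi.single (Sum.inr j) 1) = -c, by simp [c], ?_, fun e' he' => ?_⟩
  · simp only [mem_filter, mem_univ, true_and]
    intro h'
    apply hu
    rw [biVec, apply_edgeVec, h']
    simp [c]
  · have : u (biVec G e') = 0 := hS (Set.mem_image_of_mem _ he')
    rw [biVec, apply_edgeVec] at this
    simp only [mem_filter, mem_univ, true_and]
    constructor <;> intro h' <;> linarith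

theorem IsSpanBasis.exists_cut (hT : IsSpanBasis (biVec G) T) {e : BiEdge G} (he : e ∈ T) :
    ∃ A B : Finset (Fin N), e.1.1 ∈ A ∧ e.1.2 ∉ B ∧
      ∀ e' ∈ T, e' ≠ e → (e'.1.1 ∈ A ↔ e'.1.2 ∈ B) := by
  obtain ⟨A, B, hA, hB, h⟩ := exists_cut_of_notMem_span (linearIndepOn_iff_notMem_span.mp hT.1 e he)
  exact ⟨A, B, hA, hB, fun e' he' hne => h e' ⟨he', hne⟩⟩

/-- A cut separating `e` from the rest of `T` reads off the coefficient of `e`. -/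
theorem cutForm_sum_eq {A B : Finset (Fin N)} {e : BiEdge G} (heT : e ∈ T) (hA : e.1.1 ∈ A)
    (hB : e.1.2 ∉ B) (h : ∀ e' ∈ T, e' ≠ e → (e'.1.1 ∈ A ↔ e'.1.2 ∈ B)) (f : BiEdge G → ℝ) :
    cutForm A B (∑ e' ∈ T, f e' • biVec G e') = f e := by
  rw [map_sum, sum_eq_single e]
  · simp [biVec, cutForm_edgeVec, hA, hB]
  · intro e' he' hne
    by_cases h' : e'.1.2 ∈ B <;> simp [biVec, cutForm_edgeVec, h e' he' hne, h']
  · exact fun h => absurd heT h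

theorem mem_span_insert_single (hG : G.Connected) {W : Submodule ℝ (Fin N ⊕ Fin N → ℝ)}
    (hW : ∀ e, biVec G e ∈ W) {i₀ : Fin N} (h₀ : Pi.single (Sum.inl i₀) 1 ∈ W) : W = ⊤ := by
  have hr {i j : Fin N} (hij : i = j ∨ G.Adj i j) (h : Pi.single (Sum.inl i) 1 ∈ W) :
      Pi.single (Sum.inr j) 1 ∈ W := by
    simpa [biVec, edgeVec] using W.sub_mem (hW ⟨(i, j), hij⟩) h
  have hl {i j : Fin N} (hij : i = j ∨ G.Adj i j) (h : Pi.single (Sum.inr j) 1 ∈ W) :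
      Pi.single (Sum.inl i) 1 ∈ W := by
    simpa [biVec, edgeVec] using W.sub_mem (hW ⟨(i, j), hij⟩) h
  have hall (i : Fin N) : Pi.single (Sum.inl i) 1 ∈ W := by
    obtain ⟨p⟩ := hG.preconnected i₀ i
    induction p with
    | nil => exact h₀
    | cons hadj _ ih => exact ih (hl (Or.inr hadj.symm) (hr (Or.inl rfl) h₀))
  have hall' (s : Fin N ⊕ Fin N) : Pi.single s 1 ∈ W := by
    rcases s with i | j
    · exact hall i
    · exact hr (Or.inl rfl) (hall j)
  rw [eq_top_iff]
  intro p _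
  rw [pi_eq_sum_univ' p]
  refine W.sum_mem fun s _ => W.smul_mem _ ?_
  convert! hall' s using 1

theorem IsSpanBasis.span_insert_eq_top (hG : G.Connected) (hT : IsSpanBasis (biVec G) T)
    (i₀ : Fin N) :
    Submodule.span ℝ (insert (Pi.single (Sum.inl i₀) 1) (biVec G '' T)) = ⊤ :=
  mem_span_insert_single hG
    (fun e => Submodule.span_mono (Set.subset_insert _ _) (hT.2 e))
    (Submodule.subset_span (Set.mem_insert _ _))

theorem cutForm_univ_biVec (e : BiEdge G) : cutForm univ univ (biVec G e) = 0 := by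
  simp [biVec, cutForm_edgeVec]

theorem IsSpanBasis.exists_sum_eq (hG : G.Connected) (hT : IsSpanBasis (biVec G) T)
    {p : Fin N ⊕ Fin N → ℝ} (hp : cutForm univ univ p = 0) :
    ∃ f : BiEdge G → ℝ, (∀ e ∉ T, f e = 0) ∧ ∑ e ∈ T, f e • biVec G e = p := by
  obtain ⟨i₀⟩ := hG.nonempty
  have h : p ∈ Submodule.span ℝ (insert (Pi.single (Sum.inl i₀) 1) (biVec G '' T)) := by
    rw [hT.span_insert_eq_top hG]
    trivial
  obtain ⟨a, z, hz, rfl⟩ := Submodule.mem_span_insert.mp h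
  obtain ⟨c, hc⟩ := (Submodule.mem_span_image_finset_iff_exists_fun ℝ).mp hz
  have ha : a = 0 := by
    have hz0 : cutForm univ univ z = 0 := by
      rw [← hc, map_sum]
      exact sum_eq_zero fun e _ => by rw [map_smul, cutForm_univ_biVec, smul_zero]
    rw [map_add, hz0] at hp
    simpa [cutForm_apply, Pi.single_apply] using hp
  refine ⟨fun t => if h : t ∈ T then c ⟨t, h⟩ else 0, fun e he => by simp [he], ?_⟩
  rw [← sum_coe_sort, ha, zero_smul, zero_add, ← hc]
  exact sum_congr rfl fun t _ => by simp

theorem finrank_span_biVec {S : Finset (BiEdge G)}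
    (hS : LinearIndepOn ℝ (biVec G) (S : Set (BiEdge G))) :
    Module.finrank ℝ (Submodule.span ℝ (biVec G '' S)) = S.card := by
  have h := finrank_span_eq_card hS.linearIndependent
  rw [Set.image_eq_range]
  simpa using h

/-- An independent set of edges within `A × B` is a forest. -/
theorem card_lt_of_linearIndepOn {S : Finset (BiEdge G)}
    (hS : LinearIndepOn ℝ (biVec G) (S : Set (BiEdge G))) {A B : Finset (Fin N)}
    (hAB : ∀ e ∈ S, e.1.1 ∈ A ∧ e.1.2 ∈ B) (hne : (A.disjSum B).Nonempty) :
    S.card < A.card + B.card := by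
  rw [← finrank_span_biVec hS, ← card_disjSum]
  let F : Finset (Fin N ⊕ Fin N → ℝ) := (A.disjSum B).image fun s => Pi.single s 1
  set W := Submodule.span ℝ (F : Set (Fin N ⊕ Fin N → ℝ))
  have hWmem {s} (hs : s ∈ A.disjSum B) : (Pi.single s 1 : Fin N ⊕ Fin N → ℝ) ∈ W :=
    Submodule.subset_span (mem_coe.mpr (mem_image_of_mem _ hs))
  have hle : Submodule.span ℝ (biVec G '' S) ≤ W := by
    rw [Submodule.span_le]
    rintro _ ⟨e, he, rfl⟩
    exact W.add_mem (hWmem (by simpa using (hAB e he).1)) (hWmem (by simpa using (hAB e he).2))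
  have hlt : Submodule.span ℝ (biVec G '' S) < W := by
    refine lt_of_le_of_ne hle fun heq => ?_
    obtain ⟨s, hs⟩ := hne
    have h1 : (Pi.single s 1 : Fin N ⊕ Fin N → ℝ) ∈ LinearMap.ker (cutForm univ univ) := by
      have h2 : Submodule.span ℝ (biVec G '' S) ≤ LinearMap.ker (cutForm univ univ) := by
        rw [Submodule.span_le]
        rintro _ ⟨e, _, rfl⟩
        exact cutForm_univ_biVec e
      exact h2 (heq ▸ hWmem hs)
    rcases s with i | j <;> simp [cutForm_apply, Pi.single_apply] at h1
  exact (Submodule.finrank_lt_finrank_of_lt hlt).trans_le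
    ((finrank_span_finset_le_card _).trans card_image_le)

theorem IsSpanBasis.card_add_one (hG : G.Connected) (hT : IsSpanBasis (biVec G) T) :
    T.card + 1 = 2 * N := by
  obtain ⟨i₀⟩ := hG.nonempty
  refine le_antisymm ?_ ?_
  · have := card_lt_of_linearIndepOn hT.1 (A := univ) (B := univ) (by simp)
      ⟨Sum.inl i₀, by simp⟩
    simp at this
    omega
  · have h := finrank_span_finset_le_card (R := ℝ)
      (insert (Pi.single (Sum.inl i₀) 1) (T.image (biVec G)))
    rw [Set.finrank] at h
    rw [coe_insert, coe_image, hT.span_insert_eq_top hG i₀, finrank_top] at h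
    have h2 := (card_insert_le (Pi.single (Sum.inl i₀) 1) (T.image (biVec G))).trans
      (Nat.add_le_add_right card_image_le 1)
    simp at h
    omega

/-- The left degrees of a set of edges of `D(G)`. -/
noncomputable def leftDeg (T : Finset (BiEdge G)) (i : Fin N) : ℕ :=
  (T.filter fun e => e.1.1 = i).card

theorem sum_leftDeg (T : Finset (BiEdge G)) (A : Finset (Fin N)) :
    ∑ i ∈ A, leftDeg T i = (T.filter fun e => e.1.1 ∈ A).card := by
  rw [card_eq_sum_card_fiberwise (f := fun e => e.1.1) (t := A) (fun e he => by simpa using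
    (mem_filter.mp he).2)]
  refine sum_congr rfl fun i hi => ?_
  rw [leftDeg, filter_filter]
  congr 1
  ext e
  simp only [mem_filter]
  constructor
  · rintro ⟨h, rfl⟩
    exact ⟨h, hi, rfl⟩
  · rintro ⟨h, _, h'⟩
    exact ⟨h, h'⟩

theorem IsSpanBasis.leftDeg_pos (hT : IsSpanBasis (biVec G) T) (i : Fin N) : 0 < leftDeg T i := by
  by_contra h
  have h0 : ∀ e ∈ T, e.1.1 ≠ i := by
    simpa [leftDeg, filter_eq_empty_iff] using h
  have hle : Submodule.span ℝ (biVec G '' T) ≤ LinearMap.ker (LinearMap.proj (Sum.inl i)) := by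
    rw [Submodule.span_le]
    rintro _ ⟨e, he, rfl⟩
    simp [biVec, edgeVec, (h0 e he).symm]
  have := hle (hT.2 ⟨(i, i), Or.inl rfl⟩)
  simp [biVec, edgeVec] at this

theorem IsSpanBasis.sum_leftDeg_cut (hG : G.Connected) (hT : IsSpanBasis (biVec G) T)
    {A B : Finset (Fin N)} {e : BiEdge G} (heT : e ∈ T) (hA : e.1.1 ∈ A) (hB : e.1.2 ∉ B)
    (h : ∀ e' ∈ T, e' ≠ e → (e'.1.1 ∈ A ↔ e'.1.2 ∈ B)) :
    ∑ i ∈ A, leftDeg T i = A.card + B.card := by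
  rw [sum_leftDeg]
  set S₁ := (T.erase e).filter fun e' => e'.1.1 ∈ A
  set S₂ := (T.erase e).filter fun e' => ¬ e'.1.1 ∈ A
  have hsub₁ : (S₁ : Set (BiEdge G)) ⊆ T :=
    Finset.coe_subset.mpr ((filter_subset _ _).trans (erase_subset _ _))
  have hsub₂ : (S₂ : Set (BiEdge G)) ⊆ T :=
    Finset.coe_subset.mpr ((filter_subset _ _).trans (erase_subset _ _))
  have c₁ : S₁.card < A.card + B.card :=
    card_lt_of_linearIndepOn (hT.1.mono hsub₁) (fun e' he' => by
      simp only [S₁, mem_filter, mem_erase] at he'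
      exact ⟨he'.2, (h e' he'.1.2 he'.1.1).mp he'.2⟩) ⟨Sum.inl e.1.1, by simpa using hA⟩
  have c₂ : S₂.card < Aᶜ.card + Bᶜ.card :=
    card_lt_of_linearIndepOn (hT.1.mono hsub₂) (fun e' he' => by
      simp only [S₂, mem_filter, mem_erase] at he'
      simp only [mem_compl]
      exact ⟨he'.2, fun hb => he'.2 ((h e' he'.1.2 he'.1.1).mpr hb)⟩)
      ⟨Sum.inr e.1.2, by simpa using hB⟩
  have c₃ : S₁.card + S₂.card + 1 = T.card := by
    rw [card_filter_add_card_filter_not, card_erase_add_one heT]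
  have c₄ : (T.filter fun e' => e'.1.1 ∈ A).card = S₁.card + 1 := by
    rw [← insert_erase heT, filter_insert, if_pos hA, card_insert_of_notMem (by simp)]
  have c₅ := hT.card_add_one hG
  have a₁ := card_add_card_compl A
  have a₂ := card_add_card_compl B
  rw [Fintype.card_fin] at a₁ a₂
  omega

/-- The point with left marginal `a + 1 / N` and right marginal `1`. -/
noncomputable def shiftedPoint (a : Fin N → ℕ) : Fin N ⊕ Fin N → ℝ :=
  Sum.elim (fun i => (a i : ℝ) + 1 / N) fun _ => 1

theorem cutForm_shiftedPoint (A B : Finset (Fin N)) (a : Fin N → ℕ) :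
    cutForm A B (shiftedPoint a) = ((∑ i ∈ A, a i : ℕ) : ℝ) + A.card / N - B.card := by
  simp [cutForm_apply, shiftedPoint, sum_add_distrib, div_eq_mul_inv]

theorem sum_smul_biVec_inr (f : BiEdge G → ℝ) (T : Finset (BiEdge G)) (j : Fin N) :
    (∑ e ∈ T, f e • biVec G e) (Sum.inr j) = ∑ e ∈ T with e.1.2 = j, f e := by
  simp [biVec, edgeVec, Finset.sum_apply, Pi.single_apply, sum_filter, eq_comm]

theorem sum_smul_eq_of_forall_notMem {f : BiEdge G → ℝ} (hf : ∀ e ∉ T, f e = 0) :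
    ∑ e ∈ T, f e • biVec G e = ∑ e, f e • biVec G e :=
  sum_subset (subset_univ T) fun e _ he => by simp [hf e he]

theorem IsSpanBasis.sum_leftDeg_sub_one_cut (hG : G.Connected) (hT : IsSpanBasis (biVec G) T)
    {A B : Finset (Fin N)} {e : BiEdge G} (heT : e ∈ T) (hA : e.1.1 ∈ A) (hB : e.1.2 ∉ B)
    (h : ∀ e' ∈ T, e' ≠ e → (e'.1.1 ∈ A ↔ e'.1.2 ∈ B)) :
    ∑ i ∈ A, (leftDeg T i - 1) = B.card := by
  have h1 := hT.sum_leftDeg_cut hG heT hA hB h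
  have h2 : ∑ i ∈ A, leftDeg T i = ∑ i ∈ A, ((leftDeg T i - 1) + 1) :=
    sum_congr rfl fun i _ => (Nat.sub_add_cancel (hT.leftDeg_pos i)).symm
  rw [sum_add_distrib, sum_const, smul_eq_mul, mul_one] at h2
  omega

theorem IsSpanBasis.sum_leftDeg_sub_one (hG : G.Connected) (hT : IsSpanBasis (biVec G) T) :
    ∑ i, (leftDeg T i - 1) = N - 1 := by
  have h1 := sum_leftDeg T univ
  have h2 : ∑ i, leftDeg T i = ∑ i, ((leftDeg T i - 1) + 1) :=
    sum_congr rfl fun i _ => (Nat.sub_add_cancel (hT.leftDeg_pos i)).symm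
  rw [sum_add_distrib, sum_const, smul_eq_mul, mul_one, card_univ, Fintype.card_fin] at h2
  simp only [mem_univ, filter_true] at h1
  have h3 := hT.card_add_one hG
  omega

/-- The coefficients of the shifted point of the left degrees of `T` along `T`. -/
theorem IsSpanBasis.shiftedPoint_leftDeg_mem (hG : G.Connected) (hT : IsSpanBasis (biVec G) T) :
    shiftedPoint (fun i => leftDeg T i - 1) ∈ openCone (biVec G) T := by
  have hN : 0 < N := (hG.nonempty.some).pos
  have hN' : (0 : ℝ) < N := by exact_mod_cast hN
  have hbal : cutForm univ univ (shiftedPoint fun i => leftDeg T i - 1) = 0 := by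
    rw [cutForm_shiftedPoint, hT.sum_leftDeg_sub_one hG, card_univ, Fintype.card_fin,
      Nat.cast_sub hN, div_self hN'.ne']
    simp
  obtain ⟨f, hf0, hf⟩ := hT.exists_sum_eq hG hbal
  refine ⟨f, fun e he => ?_, hf0, by rw [← sum_smul_eq_of_forall_notMem hf0, hf]⟩
  obtain ⟨A, B, hA, hB, h⟩ := hT.exists_cut he
  rw [← cutForm_sum_eq he hA hB h f, hf, cutForm_shiftedPoint,
    hT.sum_leftDeg_sub_one_cut hG he hA hB h]
  have : (0 : ℝ) < A.card := by exact_mod_cast card_pos.mpr ⟨_, hA⟩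
  simpa using div_pos this hN'

/-- The shifted point of `a` lies in the open cone of `T` only if `a + 1` is the left degree
vector of `T`. -/
theorem IsSpanBasis.eq_leftDeg_of_shiftedPoint_mem (hG : G.Connected)
    (hT : IsSpanBasis (biVec G) T) {a : Fin N → ℕ}
    (ha : shiftedPoint a ∈ openCone (biVec G) T) : a = fun i => leftDeg T i - 1 := by
  have hN' : (0 : ℝ) < N := by exact_mod_cast (hG.nonempty.some).pos
  obtain ⟨f, hf1, hf0, hf⟩ := ha
  obtain ⟨g, hg1, hg0, hg⟩ := hT.shiftedPoint_leftDeg_mem hG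
  rw [← sum_smul_eq_of_forall_notMem hf0] at hf
  rw [← sum_smul_eq_of_forall_notMem hg0] at hg
  have hge : ∀ e ∈ T, g e ≤ f e := by
    intro e he
    obtain ⟨A, B, hA, hB, h⟩ := hT.exists_cut he
    have h1 := cutForm_sum_eq he hA hB h f
    have h2 := cutForm_sum_eq he hA hB h g
    rw [hf, cutForm_shiftedPoint] at h1
    rw [hg, cutForm_shiftedPoint, hT.sum_leftDeg_sub_one_cut hG he hA hB h] at h2
    have h3 : (A.card : ℝ) / N ≤ 1 := by
      rw [div_le_one hN']
      exact_mod_cast (card_le_univ A).trans (Fintype.card_fin N).le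
    have h4 : (B.card : ℝ) < (∑ i ∈ A, a i : ℕ) + 1 := by linarith [hf1 e he]
    have h5 : B.card ≤ ∑ i ∈ A, a i := by
      have : B.card < (∑ i ∈ A, a i) + 1 := by exact_mod_cast h4
      omega
    have h6 : (B.card : ℝ) ≤ (∑ i ∈ A, a i : ℕ) := by exact_mod_cast h5
    linarith
  have heq : ∀ e ∈ T, g e = f e := by
    intro e he
    have h1 := congrFun (hf) (Sum.inr e.1.2)
    have h2 := congrFun hg (Sum.inr e.1.2)
    rw [sum_smul_biVec_inr] at h1 h2
    simp only [shiftedPoint, Sum.elim_inr] at h1 h2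
    exact (sum_eq_sum_iff_of_le fun e' he' => hge e' (mem_filter.mp he').1).mp (h2.trans h1.symm)
      e (mem_filter.mpr ⟨he, rfl⟩)
  have hpt : shiftedPoint a = shiftedPoint fun i => leftDeg T i - 1 := by
    rw [← hf, ← hg]
    exact sum_congr rfl fun e he => by rw [heq e he]
  ext i
  have := congrFun hpt (Sum.inl i)
  simp only [shiftedPoint, Sum.elim_inl, add_left_inj] at this
  exact_mod_cast this

theorem isSpanGeneric_shiftedPoint {a : Fin N → ℕ} (ha : ∑ i, a i = N - 1) :
    IsSpanGeneric (biVec G) (shiftedPoint a) := by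
  intro S hS e
  by_contra he
  obtain ⟨A, B, hA, hB, h⟩ := exists_cut_of_notMem_span he
  have hN : 0 < N := e.1.1.pos
  have hN' : (0 : ℝ) < N := by exact_mod_cast hN
  have hle : Submodule.span ℝ (biVec G '' S) ≤ LinearMap.ker (cutForm A B) := by
    rw [Submodule.span_le]
    rintro _ ⟨e', he', rfl⟩
    by_cases h' : e'.1.2 ∈ B <;> simp [biVec, cutForm_edgeVec, h e' he', h']
  have h0 : cutForm A B (shiftedPoint a) = 0 := hle hS
  rw [cutForm_shiftedPoint] at h0
  field_simp at h0
  have h1 : N * (∑ i ∈ A, a i) + A.card = N * B.card := by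
    have : (N : ℝ) * (∑ i ∈ A, a i : ℕ) + A.card = N * B.card := by linarith
    exact_mod_cast this
  have hdvd : N ∣ A.card := (Nat.dvd_add_right (Dvd.intro _ rfl)).mp (h1 ▸ Dvd.intro _ rfl)
  have hAle : A.card ≤ N := (card_le_univ A).trans (Fintype.card_fin N).le
  have hAN : A.card = N := le_antisymm hAle (Nat.le_of_dvd (card_pos.mpr ⟨_, hA⟩) hdvd)
  have hAu : A = univ := by rwa [← card_eq_iff_eq_univ, Fintype.card_fin]
  have hBlt : B.card < N := by
    have := card_lt_univ_of_notMem hB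
    rwa [Fintype.card_fin] at this
  rw [hAu, ha, card_univ, Fintype.card_fin] at h1
  have h2 : N * (N - 1 + 1) = N * B.card := by rw [← h1]; ring
  have h3 := Nat.eq_of_mul_eq_mul_left hN h2
  omega

theorem draconian_of_shiftedPoint_mem_posCone {a : Fin N → ℕ} (ha : ∑ i, a i = N - 1)
    (h : shiftedPoint a ∈ posCone (biVec G)) : draconian G a := by
  refine ⟨ha, fun S hS => ?_⟩
  obtain ⟨f, hf0, hf⟩ := h
  set I := S ∪ S.biUnion fun i => nbr G i with hI
  have hN : (0 : ℝ) < N := by exact_mod_cast (hS.choose).pos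
  have hnonneg : cutForm S I (shiftedPoint a) ≤ 0 := by
    rw [← hf, map_sum]
    refine sum_nonpos fun e _ => ?_
    rw [map_smul, smul_eq_mul]
    refine mul_nonpos_of_nonneg_of_nonpos (hf0 e) ?_
    rw [biVec, cutForm_edgeVec]
    by_cases h1 : e.1.1 ∈ S
    · have h2 : e.1.2 ∈ I := by
        rcases e.2 with h' | h'
        · exact mem_union_left _ (h' ▸ h1)
        · exact mem_union_right _ (mem_biUnion.mpr ⟨_, h1, by simpa [nbr] using h'⟩)
      simp [h1, h2]
    · simp only [h1, if_false]
      split_ifs <;> norm_num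
  rw [cutForm_shiftedPoint] at hnonneg
  have : (0 : ℝ) < S.card / N := div_pos (by exact_mod_cast card_pos.mpr hS) hN
  have h2 : ((∑ i ∈ S, a i : ℕ) : ℝ) < I.card := by linarith
  exact_mod_cast h2

theorem draconian.shiftedPoint_mem_posCone {a : Fin N → ℕ} (hN : 0 < N) (h : draconian G a) :
    shiftedPoint a ∈ posCone (biVec G) := by
  have hN' : (0 : ℝ) < N := by exact_mod_cast hN
  have hcard : Fintype.card (Σ i : Fin N, Fin (N * a i + 1)) = Fintype.card (Fin N × Fin N) := by
    simp only [Fintype.card_sigma, Fintype.card_fin, Fintype.card_prod, sum_add_distrib,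
      ← mul_sum, h.1, sum_const, card_univ, smul_eq_mul, mul_one]
    conv_rhs => rw [← Nat.sub_add_cancel hN]
    obtain ⟨m, rfl⟩ : ∃ m, N = m + 1 := ⟨N - 1, by omega⟩
    simp
    ring
  let t (x : Σ i : Fin N, Fin (N * a i + 1)) : Finset (Fin N × Fin N) := (insert x.1 (nbr G x.1)) ×ˢ univ
  have hall : ∀ s : Finset (Σ i : Fin N, Fin (N * a i + 1)), s.card ≤ (s.biUnion t).card := by
    intro s
    rcases s.eq_empty_or_nonempty with rfl | hs
    · simp
    set S := s.image Sigma.fst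
    have h1 : s.card ≤ N * (∑ i ∈ S, a i) + S.card := by
      have hsub : s ⊆ S.sigma fun _ => univ := fun x hx =>
        mem_sigma.mpr ⟨mem_image_of_mem Sigma.fst hx, mem_univ _⟩
      refine (card_le_card hsub).trans ?_
      simp [card_sigma, sum_add_distrib, mul_sum]
    have h2 : s.biUnion t = (S ∪ S.biUnion fun i => nbr G i) ×ˢ univ := by
      ext ⟨j, k⟩
      simp only [t, S, mem_biUnion, mem_product, mem_univ, and_true, mem_insert, mem_union,
        mem_image]
      constructor
      · rintro ⟨x, hx, rfl | hj⟩
        · exact Or.inl ⟨x, hx, rfl⟩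
        · exact Or.inr ⟨x.1, ⟨x, hx, rfl⟩, hj⟩
      · rintro (⟨x, hx, rfl⟩ | ⟨_, ⟨x, hx, rfl⟩, hj⟩)
        · exact ⟨x, hx, Or.inl rfl⟩
        · exact ⟨x, hx, Or.inr hj⟩
    have h3 := h.2 S (hs.image _)
    have h4 : S.card ≤ N := (card_le_univ S).trans (Fintype.card_fin N).le
    rw [h2, card_product, card_univ, Fintype.card_fin, mul_comm]
    calc s.card ≤ N * (∑ i ∈ S, a i) + N := by omega
      _ = N * ((∑ i ∈ S, a i) + 1) := by ring
      _ ≤ _ := Nat.mul_le_mul_left N h3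
  obtain ⟨g, hg, hgt⟩ := (Finset.all_card_le_biUnion_card_iff_exists_injective t).mp hall
  have hbij : Function.Bijective g := (Fintype.bijective_iff_injective_and_card g).mpr ⟨hg, hcard⟩
  have hedge (x : Σ i : Fin N, Fin (N * a i + 1)) : x.1 = (g x).1 ∨ G.Adj x.1 (g x).1 := by
    have := hgt x
    simp only [t, mem_product, mem_univ, and_true, mem_insert, nbr, mem_filter, true_and] at this
    exact this.imp_left Eq.symm
  let E (x : Σ i : Fin N, Fin (N * a i + 1)) : BiEdge G := ⟨(x.1, (g x).1), hedge x⟩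
  refine ⟨fun e => (N : ℝ)⁻¹ * (univ.filter fun x => E x = e).card, fun e => by positivity, ?_⟩
  have hsum : ∑ e, ((N : ℝ)⁻¹ * (univ.filter fun x => E x = e).card) • biVec G e
      = (N : ℝ)⁻¹ • ∑ x, biVec G (E x) := by
    simp only [mul_smul, ← smul_sum]
    congr 1
    rw [← sum_fiberwise univ E]
    refine sum_congr rfl fun e _ => ?_
    rw [sum_congr rfl fun x hx => by rw [(mem_filter.mp hx).2], sum_const, Nat.cast_smul_eq_nsmul]
  rw [hsum]
  have hl (δ : Fin N → ℝ) : ∑ x : (Σ i : Fin N, Fin (N * a i + 1)), δ x.1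
      = ∑ i, ((N * a i + 1 : ℕ) : ℝ) * δ i := by
    rw [Fintype.sum_sigma]
    simp
  have hr (δ : Fin N → ℝ) : ∑ x, δ (g x).1 = ∑ j, N * δ j := by
    rw [hbij.sum_comp (fun y => δ y.1), Fintype.sum_prod_type]
    simp
  ext s
  rcases s with i | j
  · have : ∑ x : (Σ i : Fin N, Fin (N * a i + 1)), (if i = x.1 then (1 : ℝ) else 0) = N * a i + 1 :=
      (hl fun i' => if i = i' then 1 else 0).trans (by simp)
    simp [biVec, edgeVec, E, Finset.sum_apply, Pi.single_apply, shiftedPoint, this, -sum_boole]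
    field_simp
  · have : ∑ x : (Σ i : Fin N, Fin (N * a i + 1)), (if j = (g x).1 then (1 : ℝ) else 0) = N :=
      (hr fun j' => if j = j' then 1 else 0).trans (by simp)
    simp [biVec, edgeVec, E, Finset.sum_apply, Pi.single_apply, shiftedPoint, this, -sum_boole]
    field_simp

/-- The cells of a regular triangulation are counted by the draconian sequences. -/
theorem card_regularCells_eq_ncard_draconian (hG : G.Connected) {w : BiEdge G → ℝ}
    (hw : IsGenericWeight (biVec G) w) :
    {a : Fin N → ℕ | draconian G a}.ncard = (regularCells (biVec G) w).card := by
  have hN : 0 < N := (hG.nonempty.some).pos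
  have himage : {a : Fin N → ℕ | draconian G a}
      = (fun T i => leftDeg T i - 1) '' (regularCells (biVec G) w : Set (Finset (BiEdge G))) := by
    ext a
    simp only [Set.mem_ofPred_eq, Set.mem_image, mem_coe]
    constructor
    · intro ha
      obtain ⟨T, hT, hpT⟩ := exists_mem_regularCells_mem_openCone hw (cutForm univ ∅)
        (fun e => by simp [biVec, cutForm_edgeVec]) (isSpanGeneric_shiftedPoint ha.1)
        (ha.shiftedPoint_mem_posCone hN)
      exact ⟨T, hT, ((mem_filter.mp hT).2.1.eq_leftDeg_of_shiftedPoint_mem hG hpT).symm⟩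
    · rintro ⟨T, hT, rfl⟩
      have hb := (mem_filter.mp hT).2.1
      exact draconian_of_shiftedPoint_mem_posCone (hb.sum_leftDeg_sub_one hG)
        (openCone_subset_posCone (hb.shiftedPoint_leftDeg_mem hG))
  rw [himage, Set.InjOn.ncard_image, Set.ncard_coe_finset]
  intro T hT T' hT' heq
  have hT := (mem_filter.mp hT).2
  have hT' := (mem_filter.mp hT').2
  refine hT.2.eq hT'.2 (hT.1.shiftedPoint_leftDeg_mem hG) ?_
  have h := hT'.1.shiftedPoint_leftDeg_mem hG
  simp only at heq
  rwa [← heq] at h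

end EdgeVectors

section Volume

variable {N : ℕ}

/-- The coordinates kept by the projection, as elements of two copies of `Fin N`. -/
def keptCoord (N : ℕ) (k : Fin (2 * N - 2)) : Fin N ⊕ Fin N :=
  if _ : (k : ℕ) < N - 1 then Sum.inl ⟨(k : ℕ) + 1, by omega⟩
  else Sum.inr ⟨(k : ℕ) + 2 - N, by omega⟩

theorem pqVertex_projEmb (i j : Fin N) (k : Fin (2 * N - 2)) :
    pqVertex N i j (projEmb N k) = edgeVec (i, j) (keptCoord N k) := by
  have hk := k.isLt
  by_cases h : (k : ℕ) < N - 1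
  · have h1 : (k : ℕ) + 1 ≠ N + j := by omega
    simp [pqVertex, projEmb, keptCoord, edgeVec, h, Pi.single_apply, Fin.ext_iff, h1]
  · have h1 : (k : ℕ) + 2 ≠ i := by omega
    have h2 : (k : ℕ) + 2 = N + j ↔ (k : ℕ) + 2 - N = j := by omega
    simp [pqVertex, projEmb, keptCoord, edgeVec, h, Pi.single_apply, Fin.ext_iff, h1, h2]

theorem keptCoord_injective (N : ℕ) : Function.Injective (keptCoord N) := by
  intro k l h
  have hk := k.isLt
  have hl := l.isLt
  unfold keptCoord at h
  split_ifs at h with h1 h2 h2 <;> simp [Fin.ext_iff] at h <;> ext <;> omega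

/-- The deleted coordinate in the same copy of `Fin N` as the given one. -/
def baseCoord (i₀ : Fin N) : Fin N ⊕ Fin N → Fin N ⊕ Fin N :=
  Sum.map (fun _ => i₀) fun _ => i₀

theorem keptCoord_ne_baseCoord {i₀ : Fin N} (h₀ : (i₀ : ℕ) = 0) (k : Fin (2 * N - 2))
    (s : Fin N ⊕ Fin N) : keptCoord N k ≠ baseCoord i₀ s := by
  have hk := k.isLt
  unfold keptCoord
  rcases s with i | j <;> split_ifs with h <;> simp [baseCoord, Fin.ext_iff] <;> omega

theorem eq_baseCoord_or_exists_keptCoord {i₀ : Fin N} (h₀ : (i₀ : ℕ) = 0) (s : Fin N ⊕ Fin N) :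
    s = baseCoord i₀ s ∨ ∃ k, keptCoord N k = s := by
  rcases s with i | j
  · by_cases h : (i : ℕ) = 0
    · left
      simp [baseCoord, Fin.ext_iff, h, h₀]
    · right
      have := i.isLt
      refine ⟨⟨i - 1, by omega⟩, ?_⟩
      have h1 : (i : ℕ) - 1 < N - 1 := by omega
      have h2 : (i : ℕ) - 1 + 1 = i := by omega
      simp [keptCoord, h1, h2]
  · by_cases h : (j : ℕ) = 0
    · left
      simp [baseCoord, Fin.ext_iff, h, h₀]
    · right
      have := j.isLt
      refine ⟨⟨N + j - 2, by omega⟩, ?_⟩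
      have h1 : ¬ N + (j : ℕ) - 2 < N - 1 := by omega
      have h2 : N + (j : ℕ) - 2 + 2 - N = j := by omega
      simp [keptCoord, h1, h2]

/-- The linear part of the inverse of the coordinate projection. -/
noncomputable def liftLinear (i₀ : Fin N) :
    (Fin (2 * N - 2) → ℝ) →ₗ[ℝ] (Fin N ⊕ Fin N → ℝ) :=
  ∑ k, (LinearMap.proj k).smulRight
    (Pi.single (keptCoord N k) 1 - Pi.single (baseCoord i₀ (keptCoord N k)) 1)

/-- The inverse of the coordinate projection on the affine hull of the polytope. -/
noncomputable def liftAffine (i₀ : Fin N) :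
    (Fin (2 * N - 2) → ℝ) →ᵃ[ℝ] (Fin N ⊕ Fin N → ℝ) :=
  (liftLinear i₀).toAffineMap + AffineMap.const ℝ _ (edgeVec (i₀, i₀))

theorem liftAffine_apply (i₀ : Fin N) (z : Fin (2 * N - 2) → ℝ) :
    liftAffine i₀ z = liftLinear i₀ z + edgeVec (i₀, i₀) := rfl

theorem liftLinear_apply (i₀ : Fin N) (z : Fin (2 * N - 2) → ℝ) :
    liftLinear i₀ z = ∑ k, z k • ((Pi.single (keptCoord N k) 1 : Fin N ⊕ Fin N → ℝ)
      - Pi.single (baseCoord i₀ (keptCoord N k)) 1) := by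
  simp [liftLinear]

theorem liftAffine_keptCoord {i₀ : Fin N} (h₀ : (i₀ : ℕ) = 0) (z : Fin (2 * N - 2) → ℝ)
    (k : Fin (2 * N - 2)) : liftAffine i₀ z (keptCoord N k) = z k := by
  have h1 : edgeVec (i₀, i₀) (keptCoord N k) = 0 := by
    have hl := keptCoord_ne_baseCoord h₀ k (Sum.inl i₀)
    have hr := keptCoord_ne_baseCoord h₀ k (Sum.inr i₀)
    simp only [baseCoord, Sum.map_inl, Sum.map_inr] at hl hr
    simp [edgeVec, hl, hr]
  rw [liftAffine_apply, Pi.add_apply, h1, add_zero, liftLinear_apply, Finset.sum_apply,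
    sum_eq_single k]
  · simp [keptCoord_ne_baseCoord h₀]
  · intro l _ hl
    simp [keptCoord_ne_baseCoord h₀, (keptCoord_injective N).ne hl.symm]
  · simp

theorem cutForm_univ_single_sub (i₀ : Fin N) (s : Fin N ⊕ Fin N) :
    cutForm univ univ (Pi.single s 1 - Pi.single (baseCoord i₀ s) 1) = 0 := by
  rcases s with i | j <;> simp [cutForm_apply, baseCoord, Pi.single_apply]

theorem cutForm_univ_empty_single_sub (i₀ : Fin N) (s : Fin N ⊕ Fin N) :
    cutForm univ ∅ (Pi.single s 1 - Pi.single (baseCoord i₀ s) 1) = 0 := by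
  rcases s with i | j <;> simp [cutForm_apply, baseCoord, Pi.single_apply]

theorem cutForm_univ_univ_liftAffine (i₀ : Fin N) (z : Fin (2 * N - 2) → ℝ) :
    cutForm univ univ (liftAffine i₀ z) = 0 := by
  rw [liftAffine_apply, map_add, liftLinear_apply, map_sum, sum_eq_zero fun k _ => by
    rw [map_smul, cutForm_univ_single_sub, smul_zero], cutForm_edgeVec]
  simp

theorem cutForm_univ_empty_liftAffine (i₀ : Fin N) (z : Fin (2 * N - 2) → ℝ) :
    cutForm univ ∅ (liftAffine i₀ z) = 1 := by
  rw [liftAffine_apply, map_add, liftLinear_apply, map_sum, sum_eq_zero fun k _ => by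
    rw [map_smul, cutForm_univ_empty_single_sub, smul_zero], cutForm_edgeVec]
  simp

theorem eq_zero_of_forall_keptCoord {i₀ : Fin N} (h₀ : (i₀ : ℕ) = 0) {p : Fin N ⊕ Fin N → ℝ}
    (h₁ : cutForm univ univ p = 0) (h₂ : cutForm univ ∅ p = 0)
    (h : ∀ k, p (keptCoord N k) = 0) : p = 0 := by
  have hs (s) (hs : s ≠ baseCoord i₀ s) : p s = 0 := by
    obtain ⟨k, rfl⟩ := (eq_baseCoord_or_exists_keptCoord h₀ s).resolve_left hs
    exact h k
  rw [cutForm_apply] at h₁ h₂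
  have hl : ∑ i, p (Sum.inl i) = p (Sum.inl i₀) :=
    sum_eq_single i₀ (fun i _ hi => hs _ (by simpa [baseCoord] using hi)) (by simp)
  have hr : ∑ j, p (Sum.inr j) = p (Sum.inr i₀) :=
    sum_eq_single i₀ (fun i _ hi => hs _ (by simpa [baseCoord] using hi)) (by simp)
  rw [sum_empty, sub_zero] at h₂
  ext s
  by_cases h' : s = baseCoord i₀ s
  · rw [h', Pi.zero_apply]
    rcases s with i | j <;> simp only [baseCoord, Sum.map_inl, Sum.map_inr] <;> linarith
  · exact hs s h'

variable {G : SimpleGraph (Fin N)} {T : Finset (BiEdge G)}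

theorem liftAffine_biVec {i₀ : Fin N} (h₀ : (i₀ : ℕ) = 0) (e : BiEdge G) :
    liftAffine i₀ (fun k => biVec G e (keptCoord N k)) = biVec G e := by
  rw [← sub_eq_zero]
  refine eq_zero_of_forall_keptCoord h₀ ?_ ?_ fun k => ?_
  · rw [map_sub, cutForm_univ_univ_liftAffine, cutForm_univ_biVec, sub_zero]
  · rw [map_sub, cutForm_univ_empty_liftAffine, biVec, cutForm_edgeVec]
    simp
  · rw [Pi.sub_apply, liftAffine_keptCoord h₀, sub_self]

theorem exists_int_cutForm_single (A B : Finset (Fin N)) (s : Fin N ⊕ Fin N) :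
    ∃ m : ℤ, (m : ℝ) = cutForm A B (Pi.single s 1) := by
  rcases s with i | j
  · exact ⟨if i ∈ A then 1 else 0, by simp [cutForm_apply, Pi.single_apply]⟩
  · exact ⟨-if j ∈ B then 1 else 0, by simp [cutForm_apply, Pi.single_apply]⟩

theorem exists_int_biVec (e : BiEdge G) (s : Fin N ⊕ Fin N) :
    ∃ m : ℤ, (m : ℝ) = biVec G e s := by
  rcases s with i | j
  · exact ⟨if i = e.1.1 then 1 else 0, by simp [biVec, edgeVec, Pi.single_apply]⟩
  · exact ⟨if j = e.1.2 then 1 else 0, by simp [biVec, edgeVec, Pi.single_apply]⟩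

theorem abs_det_eq_one_of_mul_eq_one {n : Type*} [Fintype n] [DecidableEq n]
    {M P : Matrix n n ℝ} (hM : ∀ i j, ∃ m : ℤ, (m : ℝ) = M i j)
    (hP : ∀ i j, ∃ m : ℤ, (m : ℝ) = P i j) (h : M * P = 1) : |M.det| = 1 := by
  choose M' hM' using hM
  choose P' hP' using hP
  have h1 : M.det = ((Matrix.of M').det : ℤ) := by
    rw [show (((Matrix.of M').det : ℤ) : ℝ) = Int.castRingHom ℝ (Matrix.of M').det from rfl,
      RingHom.map_det]
    congr 1
    ext i j
    simp [hM']
  have h2 : P.det = ((Matrix.of P').det : ℤ) := by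
    rw [show (((Matrix.of P').det : ℤ) : ℝ) = Int.castRingHom ℝ (Matrix.of P').det from rfl,
      RingHom.map_det]
    congr 1
    ext i j
    simp [hP']
  have h3 : (Matrix.of M').det * (Matrix.of P').det = 1 := by
    have := congrArg Matrix.det h
    rw [Matrix.det_mul, Matrix.det_one, h1, h2] at this
    exact_mod_cast this
  rcases Int.eq_one_or_neg_one_of_mul_eq_one h3 with h | h <;> simp [h1, h]

/-- The linear map with components the given cut functionals, in projected coordinates. -/
noncomputable def cutMap (i₀ : Fin N) (A B : Fin (2 * N - 2) → Finset (Fin N)) :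
    (Fin (2 * N - 2) → ℝ) →ₗ[ℝ] (Fin (2 * N - 2) → ℝ) :=
  LinearMap.pi fun l => cutForm (A l) (B l) ∘ₗ liftLinear i₀

theorem cutMap_apply (i₀ : Fin N) (A B : Fin (2 * N - 2) → Finset (Fin N))
    (z : Fin (2 * N - 2) → ℝ) (l : Fin (2 * N - 2)) :
    cutMap i₀ A B z l = cutForm (A l) (B l) (liftLinear i₀ z) := rfl

theorem liftLinear_single (i₀ : Fin N) (k : Fin (2 * N - 2)) :
    liftLinear i₀ (Pi.single k 1) = (Pi.single (keptCoord N k) 1 : Fin N ⊕ Fin N → ℝ)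
      - Pi.single (baseCoord i₀ (keptCoord N k)) 1 := by
  rw [liftLinear_apply, sum_eq_single k] <;> simp +contextual

theorem abs_det_cutMap {i₀ : Fin N} (h₀ : (i₀ : ℕ) = 0) {A B : Fin (2 * N - 2) → Finset (Fin N)}
    {b : Fin (2 * N - 2) → BiEdge G} {e₀ : BiEdge G}
    (hb : ∀ l m, cutForm (A l) (B l) (biVec G (b m)) = if l = m then 1 else 0)
    (he₀ : ∀ l, cutForm (A l) (B l) (biVec G e₀) = 0) :
    |LinearMap.det (cutMap i₀ A B)| = 1 := by
  let P : Matrix (Fin (2 * N - 2)) (Fin (2 * N - 2)) ℝ :=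
    Matrix.of fun k l => biVec G (b l) (keptCoord N k) - biVec G e₀ (keptCoord N k)
  rw [← LinearMap.det_toMatrix']
  refine abs_det_eq_one_of_mul_eq_one (P := P) (fun l k => ?_) (fun k l => ?_) ?_
  · obtain ⟨m, hm⟩ := exists_int_cutForm_single (A l) (B l) (keptCoord N k)
    obtain ⟨m', hm'⟩ := exists_int_cutForm_single (A l) (B l) (baseCoord i₀ (keptCoord N k))
    refine ⟨m - m', ?_⟩
    rw [LinearMap.toMatrix'_apply, cutMap_apply, liftLinear_single, map_sub, ← hm, ← hm',
      Int.cast_sub]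
  · obtain ⟨m, hm⟩ := exists_int_biVec (b l) (keptCoord N k)
    obtain ⟨m', hm'⟩ := exists_int_biVec e₀ (keptCoord N k)
    exact ⟨m - m', by rw [Int.cast_sub, hm, hm']; rfl⟩
  · ext l m
    have hcol : liftLinear i₀ (fun k => P k m) = biVec G (b m) - biVec G e₀ := by
      rw [← liftAffine_biVec h₀ (b m), ← liftAffine_biVec h₀ e₀, liftAffine_apply,
        liftAffine_apply, add_sub_add_right_eq_sub, ← map_sub]
      rfl
    have : (LinearMap.toMatrix' (cutMap i₀ A B) * P) l m = cutMap i₀ A B (fun k => P k m) l := by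
      rw [← LinearMap.toMatrix'_mulVec]
      rfl
    rw [this, cutMap_apply, hcol, map_sub, hb, he₀, sub_zero, Matrix.one_apply]

/-- The coefficients of a point in a basis identify the projection of the spanned open simplex
with the open corner. -/
theorem IsSpanBasis.liftAffine_mem_openCone_iff (hG : G.Connected)
    (hT : IsSpanBasis (biVec G) T) {A B : BiEdge G → Finset (Fin N)}
    (hφ : ∀ e ∈ T, ∀ f : BiEdge G → ℝ, cutForm (A e) (B e) (∑ e ∈ T, f e • biVec G e) = f e)
    {e₀ : BiEdge G} (he₀ : e₀ ∈ T) (σ : Fin (2 * N - 2) ≃ T.erase e₀) (i₀ : Fin N)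
    (z : Fin (2 * N - 2) → ℝ) :
    liftAffine i₀ z ∈ openCone (biVec G) T ↔
      (fun l => cutForm (A (σ l)) (B (σ l)) (liftAffine i₀ z)) ∈ openCorner (2 * N - 2) := by
  have hσT (l) : (σ l : BiEdge G) ∈ T := (mem_erase.mp (σ l).2).2
  obtain ⟨f, hf0, hf⟩ := hT.exists_sum_eq hG (cutForm_univ_univ_liftAffine i₀ z)
  have hφ' (e) (he : e ∈ T) : cutForm (A e) (B e) (liftAffine i₀ z) = f e := by
    rw [← hf, hφ e he]
  have hsum : ∑ e ∈ T, f e = 1 := by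
    rw [← cutForm_univ_empty_liftAffine i₀ z, ← hf, map_sum]
    exact sum_congr rfl fun e _ => by simp [biVec, cutForm_edgeVec]
  have hsum' : ∑ l, f (σ l) + f e₀ = 1 := by
    rw [σ.sum_comp fun e => f e, sum_coe_sort (T.erase e₀), sum_erase_add _ _ he₀, hsum]
  have hmem : liftAffine i₀ z ∈ openCone (biVec G) T ↔ ∀ e ∈ T, 0 < f e := by
    constructor
    · rintro ⟨g, hg1, hg0, hg⟩ e he
      rw [← sum_smul_eq_of_forall_notMem hg0] at hg
      rw [← hφ' e he, ← hg, hφ e he]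
      exact hg1 e he
    · exact fun h => ⟨f, h, hf0, by rw [← sum_smul_eq_of_forall_notMem hf0, hf]⟩
  simp only [hmem, openCorner, Set.mem_ofPred_eq, hφ' _ (hσT _)]
  constructor
  · exact fun h => ⟨fun l => h _ (hσT l), by linarith [h e₀ he₀]⟩
  · rintro ⟨h1, h2⟩ e he
    by_cases h : e = e₀
    · rw [h]
      linarith
    · simpa using h1 (σ.symm ⟨e, mem_erase.mpr ⟨h, he⟩⟩)

/-- The projection of the open simplex spanned by a basis is open, and its normalized volume
is one. -/
theorem IsSpanBasis.isOpen_and_factorial_mul_volume (hG : G.Connected)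
    (hT : IsSpanBasis (biVec G) T) {i₀ : Fin N} (h₀ : (i₀ : ℕ) = 0) :
    IsOpen (liftAffine i₀ ⁻¹' openCone (biVec G) T) ∧
      ((2 * N - 2).factorial : ENNReal) * volume (liftAffine i₀ ⁻¹' openCone (biVec G) T) = 1 := by
  choose! A B hA hB hAB using fun e (he : e ∈ T) => hT.exists_cut he
  have hφ (e) (he : e ∈ T) (f : BiEdge G → ℝ) :
      cutForm (A e) (B e) (∑ e ∈ T, f e • biVec G e) = f e :=
    cutForm_sum_eq he (hA e he) (hB e he) (hAB e he) f
  have hcard := hT.card_add_one hG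
  obtain ⟨e₀, he₀⟩ : T.Nonempty := card_pos.mp (by have := i₀.pos; omega)
  let σ : Fin (2 * N - 2) ≃ T.erase e₀ :=
    ((T.erase e₀).equivFinOfCardEq (by rw [card_erase_of_mem he₀]; omega)).symm
  have hσT (l) : (σ l : BiEdge G) ∈ T := (mem_erase.mp (σ l).2).2
  have hval (l) (e : BiEdge G) (he : e ∈ T) :
      cutForm (A (σ l)) (B (σ l)) (biVec G e) = if (σ l : BiEdge G) = e then 1 else 0 := by
    simpa [he] using hφ _ (hσT l) fun e' => if e' = e then (1 : ℝ) else 0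
  have hdet := abs_det_cutMap h₀ (A := fun l => A (σ l)) (B := fun l => B (σ l))
    (b := fun l => (σ l : BiEdge G)) (e₀ := e₀)
    (fun l m => by simp [hval l _ (hσT m)])
    (fun l => by rw [hval l _ he₀, if_neg (mem_erase.mp (σ l).2).1])
  set M := cutMap i₀ (fun l => A (σ l)) (fun l => B (σ l))
  let c (l : Fin (2 * N - 2)) : ℝ := cutForm (A (σ l)) (B (σ l)) (edgeVec (i₀, i₀))
  have hpre : liftAffine i₀ ⁻¹' openCone (biVec G) T
      = M ⁻¹' ((fun x => c + x) ⁻¹' openCorner (2 * N - 2)) := by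
    ext z
    refine (hT.liftAffine_mem_openCone_iff hG hφ he₀ σ i₀ z).trans ?_
    have : (fun l => cutForm (A (σ l)) (B (σ l)) (liftAffine i₀ z)) = c + M z :=
      funext fun l => by rw [liftAffine_apply, map_add, add_comm]; rfl
    rw [this]
    rfl
  have hdet0 : LinearMap.det M ≠ 0 := fun h => by simp [h] at hdet
  refine ⟨?_, ?_⟩
  · rw [hpre]
    exact ((isOpen_openCorner _).preimage (by fun_prop)).preimage
      (LinearMap.continuous_of_finiteDimensional M)
  · rw [hpre, Measure.addHaar_preimage_linearMap _ hdet0, measure_preimage_add, abs_inv, hdet]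
    simpa using factorial_mul_volume_openCorner (2 * N - 2)

theorem convex_posCone {ι κ : Type*} [Fintype ι] (v : ι → κ → ℝ) : Convex ℝ (posCone v) := by
  rintro _ ⟨f, hf, rfl⟩ _ ⟨g, hg, rfl⟩ a b ha hb _
  refine ⟨fun e => a * f e + b * g e, fun e =>
    add_nonneg (mul_nonneg ha (hf e)) (mul_nonneg hb (hg e)), ?_⟩
  simp only [add_smul, mul_smul, sum_add_distrib, smul_sum]

theorem image_adjPolytopePQ {i₀ : Fin N} (h₀ : (i₀ : ℕ) = 0) :
    (fun x (k : Fin (2 * N - 2)) => x (projEmb N k)) '' adjPolytopePQ G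
      = liftAffine i₀ ⁻¹' posCone (biVec G) := by
  have hrange : (fun x (k : Fin (2 * N - 2)) => x (projEmb N k)) '' adjPolytopePQ G
      = convexHull ℝ (Set.range fun (e : BiEdge G) k => biVec G e (keptCoord N k)) := by
    have h := (LinearMap.funLeft ℝ ℝ (projEmb N)).image_convexHull
      {x | ∃ i j : Fin N, (i = j ∨ G.Adj i j) ∧ x = pqVertex N i j}
    refine h.trans (congrArg _ ?_)
    ext z
    constructor
    · rintro ⟨_, ⟨i, j, hij, rfl⟩, rfl⟩
      exact ⟨⟨(i, j), hij⟩, funext fun k => (pqVertex_projEmb i j k).symm⟩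
    · rintro ⟨e, rfl⟩
      exact ⟨_, ⟨e.1.1, e.1.2, e.2, rfl⟩, funext fun k => pqVertex_projEmb _ _ k⟩
  rw [hrange]
  refine Set.Subset.antisymm (convexHull_min ?_ ((convex_posCone _).affine_preimage _)) ?_
  · rintro _ ⟨e, rfl⟩
    refine ⟨Pi.single e 1, fun e' => by by_cases h : e' = e <;> simp [h], ?_⟩
    rw [liftAffine_biVec h₀, sum_eq_single e] <;> simp +contextual
  · rintro z ⟨f, hf0, hf⟩
    refine mem_convexHull_of_exists_fintype f _ hf0 ?_ (fun e => ⟨e, rfl⟩) ?_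
    · rw [← cutForm_univ_empty_liftAffine i₀ z, ← hf, map_sum]
      exact sum_congr rfl fun e _ => by simp [biVec, cutForm_edgeVec]
    · ext k
      rw [← liftAffine_keptCoord h₀ z k, ← hf]
      simp [Finset.sum_apply]

theorem ae_isSpanGeneric_liftAffine {i₀ : Fin N} (h₀ : (i₀ : ℕ) = 0) :
    ∀ᵐ z, IsSpanGeneric (biVec G) (liftAffine i₀ z) := by
  refine ae_all_iff.mpr fun S => ?_
  by_cases hS : ∀ e, biVec G e ∈ Submodule.span ℝ (biVec G '' S)
  · exact Filter.Eventually.of_forall fun _ _ => hS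
  push Not at hS
  obtain ⟨e, he⟩ := hS
  have hnull := Measure.addHaar_affineSubspace volume
    ((Submodule.span ℝ (biVec G '' S)).toAffineSubspace.comap (liftAffine i₀)) (fun htop => he (by
      have : (fun k => biVec G e (keptCoord N k)) ∈
          (Submodule.span ℝ (biVec G '' S)).toAffineSubspace.comap (liftAffine i₀) := by
        rw [htop]
        trivial
      rw [AffineSubspace.mem_comap, liftAffine_biVec h₀] at this
      exact this))
  filter_upwards [measure_eq_zero_iff_ae_notMem.mp hnull] with z hz hz'
  exact absurd hz' hz

end Volume

/-- For a connected graph `G` on `[N]`, the normalized volume of `∇^PQ_G` — that is,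
`(2N-2)!` times the Lebesgue measure of the image of `∇^PQ_G` under the coordinate
projection deleting coordinates `1` and `N+1` — equals the number of `D(G)`-draconian
sequences. -/
theorem nvol_adjPolytopePQ_eq_ncard_draconian {N : ℕ} (G : SimpleGraph (Fin N))
    (hG : G.Connected) :
    (Nat.factorial (2 * N - 2) : ENNReal) *
        volume ((fun x (k : Fin (2 * N - 2)) => x (projEmb N k)) '' adjPolytopePQ G) =
      ({a : Fin N → ℕ | draconian G a}.ncard : ENNReal) := by
  obtain ⟨w, hw⟩ := exists_isGenericWeight (biVec G)
  let i₀ : Fin N := ⟨0, (hG.nonempty.some).pos⟩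
  have h₀ : (i₀ : ℕ) = 0 := rfl
  have hb {T} (hT : T ∈ regularCells (biVec G) w) := (mem_filter.mp hT).2
  have hunion : (⋃ T ∈ regularCells (biVec G) w, liftAffine i₀ ⁻¹' openCone (biVec G) T)
      =ᵐ[volume] liftAffine i₀ ⁻¹' posCone (biVec G) := by
    filter_upwards [ae_isSpanGeneric_liftAffine (G := G) h₀] with z hz
    refine propext ⟨fun h => ?_, fun h => ?_⟩
    · obtain ⟨T, _, hzT⟩ := Set.mem_iUnion₂.mp h
      exact openCone_subset_posCone hzT
    · exact Set.mem_iUnion₂.mpr <| by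
        simpa using exists_mem_regularCells_mem_openCone hw (cutForm univ ∅)
          (fun e => by simp [biVec, cutForm_edgeVec]) hz h
  rw [image_adjPolytopePQ h₀, ← measure_congr hunion, measure_biUnion_finset, mul_sum,
    sum_congr rfl fun T hT => ((hb hT).1.isOpen_and_factorial_mul_volume hG h₀).2, sum_const,
    card_regularCells_eq_ncard_draconian hG hw, nsmul_eq_mul, mul_one]
  · intro T hT T' hT' hne
    exact Set.disjoint_left.mpr fun z hz hz' => hne ((hb hT).2.eq (hb hT').2 hz hz')
  · exact fun T hT => ((hb hT).1.isOpen_and_factorial_mul_volume hG h₀).1.measurableSet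
end

section
/- Let N > 2 and let M be a matching of size k in the complete graph K_N on [N] (i.e., a set of k pairwise disjoint edges). Then the number of D(K_N ∖ M)-draconian sequences, which equals NVol(∇^PQ_{K_N ∖ M}), is binom(2(N−1), N−1) − 2k, where K_N ∖ M is K_N with the edges of M deleted. -/
open Finset

attribute [local instance] Classical.propDecidable

/-- There are `(N + n - 1).choose n` functions `Fin N → ℕ` with sum `n`. -/
lemma ncard_setOf_sum_eq (N n : ℕ) :
    {a : Fin N → ℕ | ∑ i, a i = n}.ncard = (N + n - 1).choose n := by
  have h : {a : Fin N → ℕ | ∑ i, a i = n} =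
      (fun f : Fin N →₀ ℕ => (f : Fin N → ℕ)) ''
        (univ.finsuppAntidiag n : Finset (Fin N →₀ ℕ)) := by
    ext a
    simp only [Set.mem_ofPred_eq, Set.mem_image, mem_coe, mem_finsuppAntidiag]
    constructor
    · intro ha
      exact ⟨Finsupp.equivFunOnFinite.symm a, ⟨ha, subset_univ _⟩, rfl⟩
    · rintro ⟨f, ⟨hf, -⟩, rfl⟩
      exact hf
  rw [h, Set.ncard_image_of_injective _ DFunLike.coe_injective, Set.ncard_coe_finset,
    card_finsuppAntidiag_nat_eq_choose, card_univ, Fintype.card_fin]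

/-- A vertex is outside the closed neighborhood of `S` in `K_N ∖ M` iff it is outside `S` and
`M` joins it to every vertex of `S`. -/
lemma notMem_union_biUnion_nbr_iff {N : ℕ} (M : Finset (Sym2 (Fin N))) (S : Finset (Fin N))
    (j : Fin N) :
    j ∉ S ∪ S.biUnion (fun i => nbr ((⊤ : SimpleGraph (Fin N)).deleteEdges ↑M) i) ↔
      j ∉ S ∧ ∀ i ∈ S, s(i, j) ∈ M := by
  simp only [nbr, mem_union, mem_biUnion, mem_filter, mem_univ, true_and,
    SimpleGraph.deleteEdges_adj, SimpleGraph.top_adj, mem_coe, not_or, not_exists, not_and,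
    not_not]
  refine and_congr_right fun hj => forall₂_congr fun i hi => ?_
  have hij : i ≠ j := fun h => hj (h ▸ hi)
  simp [hij]

/-- The draconian sequences of `K_N ∖ M`, for a matching `M`, are those with sum `N - 1` in which
no vertex covered by `M` carries the whole sum. -/
lemma draconian_complete_minus_matching_iff {N : ℕ} (M : Finset (Sym2 (Fin N)))
    (hdiag : ∀ e ∈ M, ¬ e.IsDiag)
    (hdisj : ∀ e ∈ M, ∀ f ∈ M, e ≠ f → ∀ x : Fin N, x ∈ e → x ∉ f) (a : Fin N → ℕ) :
    draconian ((⊤ : SimpleGraph (Fin N)).deleteEdges ↑M) a ↔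
      ∑ i, a i = N - 1 ∧ ∀ i ∈ M.biUnion Sym2.toFinset, a i ≠ N - 1 := by
  have hle : ∀ S : Finset (Fin N), ∑ i ∈ S, a i ≤ ∑ i, a i := fun S =>
    sum_le_sum_of_subset (subset_univ S)
  have huniq : ∀ e ∈ M, ∀ f ∈ M, ∀ x, x ∈ e → x ∈ f → e = f := fun e he f hf x hxe hxf =>
    by_contra fun hne => hdisj e he f hf hne x hxe hxf
  refine and_congr_right fun hsum => ⟨fun h i hi hai => ?_, fun h S hS => ?_⟩
  · obtain ⟨e, he, hie⟩ := mem_biUnion.1 hi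
    obtain ⟨j, rfl⟩ := Sym2.mem_toFinset.1 hie
    have hji : j ≠ i := fun hji => hdiag _ he hji.symm
    have hj := (notMem_union_biUnion_nbr_iff M {i} j).2 (by simp [hji, he])
    have hlt := h {i} (singleton_nonempty i)
    have hcard := card_le_card (subset_erase.2 ⟨subset_univ _, hj⟩)
    rw [card_erase_of_mem (mem_univ j), card_univ, Fintype.card_fin] at hcard
    rw [sum_singleton] at hlt
    omega
  · obtain ⟨i, hi⟩ := hS
    set T := S ∪ S.biUnion (fun i => nbr ((⊤ : SimpleGraph (Fin N)).deleteEdges ↑M) i)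
    have hN : 0 < N := i.pos
    by_cases hTu : T = univ
    · rw [hTu, card_univ, Fintype.card_fin]
      have := hle S
      omega
    · obtain ⟨j, hj⟩ : ∃ j, j ∉ T := by simpa [eq_univ_iff_forall] using hTu
      have hjM := ((notMem_union_biUnion_nbr_iff M S j).1 hj).2
      have hS : S = {i} := eq_singleton_iff_unique_mem.2 ⟨hi, fun i' hi' =>
        Sym2.congr_left.1 (huniq _ (hjM i' hi') _ (hjM i hi) j (by simp) (by simp))⟩
      have hsub : univ.erase j ⊆ T := fun j' hj' => by
        by_contra hj'T
        have hj'M := ((notMem_union_biUnion_nbr_iff M S j').1 hj'T).2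
        exact ne_of_mem_erase hj' (Sym2.congr_right.1
          (huniq _ (hj'M i hi) _ (hjM i hi) i (by simp) (by simp)))
      have hcard := card_le_card hsub
      rw [card_erase_of_mem (mem_univ j), card_univ, Fintype.card_fin] at hcard
      have hai := h i (mem_biUnion.2 ⟨_, hjM i hi, by simp⟩)
      have hsumle := hle S
      rw [hS, sum_singleton] at hsumle ⊢
      omega

/-- A matching of size `k` covers `2 * k` vertices. -/
lemma card_biUnion_toFinset_of_matching {N : ℕ} (M : Finset (Sym2 (Fin N)))
    (hdiag : ∀ e ∈ M, ¬ e.IsDiag)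
    (hdisj : ∀ e ∈ M, ∀ f ∈ M, e ≠ f → ∀ x : Fin N, x ∈ e → x ∉ f) :
    (M.biUnion Sym2.toFinset).card = 2 * M.card := by
  rw [card_biUnion fun e he f hf hef => disjoint_left.2 fun x hxe hxf =>
      hdisj e he f hf hef x (Sym2.mem_toFinset.1 hxe) (Sym2.mem_toFinset.1 hxf),
    sum_congr rfl fun e he => Sym2.card_toFinset_of_not_isDiag e (hdiag e he),
    sum_const, smul_eq_mul, mul_comm]

/-- A function with sum `n` that takes the value `n` at `i` vanishes elsewhere. -/
lemma eq_single_of_sum_eq {ι : Type*} [Fintype ι] [DecidableEq ι] {a : ι → ℕ} {n : ℕ} {i : ι}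
    (hsum : ∑ j, a j = n) (hi : a i = n) : a = Pi.single i n := by
  have h := add_sum_erase univ a (mem_univ i)
  have h0 : ∑ j ∈ univ.erase i, a j = 0 := by omega
  ext j
  rcases eq_or_ne j i with rfl | hj
  · simp [hi]
  · simpa [hj] using sum_eq_zero_iff.1 h0 j (mem_erase.2 ⟨hj, mem_univ j⟩)

/-- Let `N > 2` and let `M` be a matching of size `k` in `K_N` (a set of `k` pairwise
disjoint edges). Then the number of `D(K_N ∖ M)`-draconian sequences, which equals
`NVol(∇^PQ_{K_N ∖ M})`, is `binom(2(N-1), N-1) - 2k`. -/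
theorem ncard_draconian_complete_minus_matching {N k : ℕ} (hN : 2 < N)
    (M : Finset (Sym2 (Fin N))) (hcard : M.card = k)
    (hdiag : ∀ e ∈ M, ¬ e.IsDiag)
    (hdisj : ∀ e ∈ M, ∀ f ∈ M, e ≠ f → ∀ x : Fin N, x ∈ e → x ∉ f) :
    {a : Fin N → ℕ | draconian ((⊤ : SimpleGraph (Fin N)).deleteEdges ↑M) a}.ncard =
      Nat.choose (2 * (N - 1)) (N - 1) - 2 * k := by
  have hset : {a : Fin N → ℕ | draconian ((⊤ : SimpleGraph (Fin N)).deleteEdges ↑M) a} =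
      {a : Fin N → ℕ | ∑ i, a i = N - 1} \
        (fun i : Fin N => (Pi.single i (N - 1) : Fin N → ℕ)) ''
          (M.biUnion Sym2.toFinset : Finset (Fin N)) := by
    ext a
    simp only [Set.mem_ofPred_eq, Set.mem_sdiff, Set.mem_image, mem_coe,
      draconian_complete_minus_matching_iff M hdiag hdisj]
    refine and_congr_right fun hsum => ⟨?_, fun h i hi hai => ?_⟩
    · rintro h ⟨i, hi, rfl⟩
      exact h i hi (Pi.single_eq_same i _)
    · exact h ⟨i, hi, (eq_single_of_sum_eq hsum hai).symm⟩
  have hinj : Function.Injective (fun i : Fin N => (Pi.single i (N - 1) : Fin N → ℕ)) :=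
    fun i j hij => by
      by_contra hne
      have h := congrFun hij i
      simp only [Pi.single_eq_same, Pi.single_eq_of_ne hne] at h
      omega
  rw [hset, Set.ncard_sdiff _ (Set.toFinite _), ncard_setOf_sum_eq,
    Set.ncard_image_of_injective _ hinj, Set.ncard_coe_finset,
    card_biUnion_toFinset_of_matching M hdiag hdisj, hcard,
    show N + (N - 1) - 1 = 2 * (N - 1) by omega]
  rintro _ ⟨i, -, rfl⟩
  simp
end

section
/- Let G be a connected simple graph on [N] and let 1 < M < N. Suppose every edge of G has both endpoints in [M] or both endpoints in {1} ∪ {M+1,…,N} (so vertex 1 is a cut-vertex separating the induced subgraph B = G[[M]] from B' = G[{1, M+1,…,N}]). Regard B as a graph on [M], and regard B' as a graph on [N−M+1] via the order-preserving relabeling 1 ↦ 1 and M+i ↦ i+1. Then |𝔇(G)| = |𝔇(B)| · |𝔇(B')|; equivalently, NVol(∇^PQ_G) = NVol(∇^PQ_B) · NVol(∇^PQ_{B'}). -/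
open Finset

attribute [local instance] Classical.propDecidable

/-- The closed neighborhood of a set of vertices. -/
noncomputable def closedNbr {N : ℕ} (G : SimpleGraph (Fin N)) (S : Finset (Fin N)) :
    Finset (Fin N) :=
  S ∪ S.biUnion (fun i => nbr G i)

theorem mem_closedNbr {N : ℕ} {G : SimpleGraph (Fin N)} {S : Finset (Fin N)} {v : Fin N} :
    v ∈ closedNbr G S ↔ v ∈ S ∨ ∃ u ∈ S, G.Adj u v := by
  simp [closedNbr, nbr]

theorem subset_closedNbr {N : ℕ} (G : SimpleGraph (Fin N)) (S : Finset (Fin N)) :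
    S ⊆ closedNbr G S :=
  subset_union_left

/-- `G` is covered by the images of `f` and `g`, which meet only in the vertex `f p = g q`, and
every edge of `G` lies within one of the two images. -/
structure IsVertexGluing {N m k : ℕ} (G : SimpleGraph (Fin N)) (f : Fin m → Fin N)
    (g : Fin k → Fin N) (p : Fin m) (q : Fin k) : Prop where
  injective_left : Function.Injective f
  injective_right : Function.Injective g
  apply_eq : f p = g q
  eq_of_apply_eq : ∀ i j, f i = g j → i = p ∧ j = q
  cover : ∀ v, (∃ i, f i = v) ∨ ∃ j, g j = v
  adj : ∀ u v, G.Adj u v → ((∃ i, f i = u) ∧ ∃ i, f i = v) ∨ ((∃ j, g j = u) ∧ ∃ j, g j = v)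

/-- The sum of the extensions by zero of `b` and `c` along `f` and `g`. -/
noncomputable def glueSum {N m k : ℕ} (f : Fin m → Fin N) (g : Fin k → Fin N)
    (x : (Fin m → ℕ) × (Fin k → ℕ)) (v : Fin N) : ℕ :=
  (∑ i with f i = v, x.1 i) + ∑ j with g j = v, x.2 j

theorem sum_glueSum {N m k : ℕ} (f : Fin m → Fin N) (g : Fin k → Fin N)
    (x : (Fin m → ℕ) × (Fin k → ℕ)) (S : Finset (Fin N)) :
    ∑ v ∈ S, glueSum f g x v = (∑ i with f i ∈ S, x.1 i) + ∑ j with g j ∈ S, x.2 j := by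
  have key : ∀ {l : ℕ} (h : Fin l → Fin N) (y : Fin l → ℕ),
      ∑ v ∈ S, ∑ i with h i = v, y i = ∑ i with h i ∈ S, y i := by
    intro l h y
    simp_rw [sum_filter]
    rw [sum_comm]
    simp
  simp only [glueSum, sum_add_distrib, key]

/-- The sequence agreeing with `a ∘ f` away from `p`, with total `m - 1`. -/
noncomputable def normalizedRestrict {N m : ℕ} (f : Fin m → Fin N) (p : Fin m) (a : Fin N → ℕ) :
    Fin m → ℕ :=
  Function.update (a ∘ f) p (m - 1 - ∑ i ∈ univ.erase p, a (f i))

namespace IsVertexGluing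

variable {N m k : ℕ} {G : SimpleGraph (Fin N)} {f : Fin m → Fin N} {g : Fin k → Fin N}
  {p : Fin m} {q : Fin k}

theorem symm (h : IsVertexGluing G f g p q) : IsVertexGluing G g f q p where
  injective_left := h.injective_right
  injective_right := h.injective_left
  apply_eq := h.apply_eq.symm
  eq_of_apply_eq i j e := (h.eq_of_apply_eq j i e.symm).symm
  cover v := (h.cover v).symm
  adj u v e := (h.adj u v e).symm

theorem sum_image_union (h : IsVertexGluing G f g p q) (a : Fin N → ℕ) {S : Finset (Fin m)}
    {T : Finset (Fin k)} (hp : p ∈ S) (hq : q ∈ T) :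
    ∑ v ∈ S.image f ∪ T.image g, a v + a (f p) = ∑ i ∈ S, a (f i) + ∑ j ∈ T, a (g j) := by
  have hi : S.image f ∩ T.image g = {f p} := by
    ext v
    simp only [mem_inter, mem_image, mem_singleton]
    constructor
    · rintro ⟨⟨i, -, rfl⟩, j, -, e⟩
      rw [(h.eq_of_apply_eq i j e.symm).1]
    · rintro rfl
      exact ⟨⟨p, hp, rfl⟩, q, hq, h.apply_eq.symm⟩
  have := sum_union_inter (s₁ := S.image f) (s₂ := T.image g) (f := a)
  rw [hi, sum_singleton, sum_image h.injective_left.injOn,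
    sum_image h.injective_right.injOn] at this
  exact this

theorem card_image_union (h : IsVertexGluing G f g p q) {S : Finset (Fin m)}
    {T : Finset (Fin k)} (hp : p ∈ S) (hq : q ∈ T) :
    (S.image f ∪ T.image g).card + 1 = S.card + T.card := by
  simpa using h.sum_image_union (fun _ => 1) hp hq

theorem card_add_card_le (h : IsVertexGluing G f g p q) (S : Finset (Fin m))
    (T : Finset (Fin k)) : S.card + T.card ≤ (S.image f ∪ T.image g).card + 1 := by
  have hi : (S.image f ∩ T.image g).card ≤ 1 := by
    refine (card_le_card (t := {f p}) fun v hv => ?_).trans (card_singleton _).le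
    simp only [mem_inter, mem_image] at hv
    obtain ⟨⟨i, -, rfl⟩, j, -, e⟩ := hv
    rw [(h.eq_of_apply_eq i j e.symm).1, mem_singleton]
  have := card_union_add_card_inter (S.image f) (T.image g)
  rw [card_image_of_injective _ h.injective_left,
    card_image_of_injective _ h.injective_right] at this
  omega

theorem image_univ_union (h : IsVertexGluing G f g p q) :
    univ.image f ∪ univ.image g = univ := by
  ext v
  simpa using h.cover v

theorem card_add_one (h : IsVertexGluing G f g p q) : N + 1 = m + k := by
  have := h.card_image_union (mem_univ p) (mem_univ q)
  rw [h.image_univ_union] at this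
  simpa using this

theorem closedNbr_image_union (h : IsVertexGluing G f g p q) {S : Finset (Fin m)}
    {T : Finset (Fin k)} (hpq : p ∈ S ↔ q ∈ T) :
    closedNbr G (S.image f ∪ T.image g) =
      (closedNbr (G.comap f) S).image f ∪ (closedNbr (G.comap g) T).image g := by
  ext v
  simp only [mem_closedNbr, mem_union, mem_image, SimpleGraph.comap_adj]
  constructor
  · rintro ((⟨i, hi, rfl⟩ | ⟨j, hj, rfl⟩) | ⟨u, (⟨i, hi, rfl⟩ | ⟨j, hj, rfl⟩), hadj⟩)
    · exact .inl ⟨i, .inl hi, rfl⟩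
    · exact .inr ⟨j, .inl hj, rfl⟩
    · obtain ⟨-, i', rfl⟩ | ⟨⟨j, hj⟩, j', rfl⟩ := h.adj _ _ hadj
      · exact .inl ⟨i', .inr ⟨i, hi, hadj⟩, rfl⟩
      · obtain ⟨rfl, rfl⟩ := h.eq_of_apply_eq _ _ hj.symm
        exact .inr ⟨j', .inr ⟨j, hpq.1 hi, hj ▸ hadj⟩, rfl⟩
    · obtain ⟨⟨i, hi⟩, i', rfl⟩ | ⟨-, j', rfl⟩ := h.adj _ _ hadj
      · obtain ⟨rfl, rfl⟩ := h.eq_of_apply_eq _ _ hi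
        exact .inl ⟨i', .inr ⟨i, hpq.2 hj, hi ▸ hadj⟩, rfl⟩
      · exact .inr ⟨j', .inr ⟨j, hj, hadj⟩, rfl⟩
  · rintro (⟨i, (hi | ⟨i', hi', hadj⟩), rfl⟩ | ⟨j, (hj | ⟨j', hj', hadj⟩), rfl⟩)
    · exact .inl (.inl ⟨i, hi, rfl⟩)
    · exact .inr ⟨_, .inl ⟨i', hi', rfl⟩, hadj⟩
    · exact .inl (.inr ⟨j, hj, rfl⟩)
    · exact .inr ⟨_, .inr ⟨j', hj', rfl⟩, hadj⟩

theorem closedNbr_image (h : IsVertexGluing G f g p q) {S : Finset (Fin m)} (hp : p ∉ S) :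
    closedNbr G (S.image f) = (closedNbr (G.comap f) S).image f := by
  have := h.closedNbr_image_union (S := S) (T := ∅) (by simp [hp])
  simpa [closedNbr] using this

theorem draconian_glueSum (h : IsVertexGluing G f g p q) {x : (Fin m → ℕ) × (Fin k → ℕ)}
    (hb : draconian (G.comap f) x.1) (hc : draconian (G.comap g) x.2) :
    draconian G (glueSum f g x) := by
  have hN := h.card_add_one
  have hm := p.pos
  have hk := q.pos
  refine ⟨?_, fun S hS => ?_⟩
  · rw [sum_glueSum]
    simp only [mem_univ, filter_true, hb.1, hc.1]
    omega
  · rw [sum_glueSum]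
    change _ < (closedNbr G S).card
    set S₁ : Finset (Fin m) := univ.filter fun i => f i ∈ S with hS₁
    set S₂ : Finset (Fin k) := univ.filter fun j => g j ∈ S with hS₂
    have hpq : p ∈ S₁ ↔ q ∈ S₂ := by simp [hS₁, hS₂, h.apply_eq]
    have hSe : S₁.image f ∪ S₂.image g = S := by
      ext v
      simp only [hS₁, hS₂, mem_union, mem_image, mem_filter, mem_univ, true_and]
      constructor
      · rintro (⟨i, hi, rfl⟩ | ⟨j, hj, rfl⟩) <;> assumption
      · intro hv
        obtain ⟨i, rfl⟩ | ⟨j, rfl⟩ := h.cover v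
        exacts [.inl ⟨i, hv, rfl⟩, .inr ⟨j, hv, rfl⟩]
    have hD := h.closedNbr_image_union hpq
    rw [hSe] at hD
    have h₁ : S₁.Nonempty → ∑ i ∈ S₁, x.1 i < (closedNbr (G.comap f) S₁).card := hb.2 S₁
    have h₂ : S₂.Nonempty → ∑ j ∈ S₂, x.2 j < (closedNbr (G.comap g) S₂).card := hc.2 S₂
    obtain e₁ | n₁ := S₁.eq_empty_or_nonempty
    · rw [e₁] at hSe hD ⊢
      have n₂ : S₂.Nonempty := by
        rw [← hSe] at hS
        simpa using hS
      have := h₂ n₂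
      rw [hD]
      simpa [closedNbr, card_image_of_injective _ h.injective_right] using this
    · obtain e₂ | n₂ := S₂.eq_empty_or_nonempty
      · have := h₁ n₁
        rw [hD, e₂]
        simpa [closedNbr, card_image_of_injective _ h.injective_left] using this
      · have := h.card_add_card_le (closedNbr (G.comap f) S₁) (closedNbr (G.comap g) S₂)
        have := h₁ n₁
        have := h₂ n₂
        rw [hD]
        omega

theorem sum_erase_lt (h : IsVertexGluing G f g p q) (hm : 1 < m) {a : Fin N → ℕ}
    (ha : draconian G a) : ∑ i ∈ univ.erase p, a (f i) < m := by
  have hne : (univ.erase p).Nonempty := by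
    rw [← card_pos, card_erase_of_mem (mem_univ p), card_fin]
    omega
  have := ha.2 ((univ.erase p).image f) (hne.image f)
  change _ < (closedNbr G _).card at this
  rw [h.closedNbr_image (by simp), card_image_of_injective _ h.injective_left,
    sum_image h.injective_left.injOn] at this
  exact this.trans_le (card_finset_fin_le _)

theorem sum_normalizedRestrict_add (f : Fin m → Fin N) (a : Fin N → ℕ) {S : Finset (Fin m)}
    (hp : p ∈ S) :
    ∑ i ∈ S, normalizedRestrict f p a i + a (f p) =
      ∑ i ∈ S, a (f i) + normalizedRestrict f p a p := by
  rw [← add_sum_erase _ _ hp, ← add_sum_erase S (fun i => a (f i)) hp]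
  have : ∑ i ∈ S.erase p, normalizedRestrict f p a i = ∑ i ∈ S.erase p, a (f i) :=
    sum_congr rfl fun i hi => by simp [normalizedRestrict, ne_of_mem_erase hi]
  omega

theorem normalizedRestrict_self_add (h : IsVertexGluing G f g p q) (hm : 1 < m)
    {a : Fin N → ℕ} (ha : draconian G a) :
    normalizedRestrict f p a p + ∑ i, a (f i) = m - 1 + a (f p) := by
  have := h.sum_erase_lt hm ha
  have e := add_sum_erase univ (fun i => a (f i)) (mem_univ p)
  simp only [normalizedRestrict, Function.update_self]
  omega

theorem draconian_normalizedRestrict (h : IsVertexGluing G f g p q) (hm : 1 < m)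
    {a : Fin N → ℕ} (ha : draconian G a) :
    draconian (G.comap f) (normalizedRestrict f p a) := by
  have hself := h.normalizedRestrict_self_add hm ha
  refine ⟨?_, fun S hS => ?_⟩
  · have := sum_normalizedRestrict_add f a (mem_univ p)
    omega
  · change _ < (closedNbr _ S).card
    by_cases hp : p ∈ S
    · have hlt := ha.2 (S.image f ∪ univ.image g) ((hS.image f).mono subset_union_left)
      change _ < (closedNbr G _).card at hlt
      have huniv : closedNbr (G.comap g) univ = univ :=
        univ_subset_iff.1 (subset_closedNbr _ _)
      rw [h.closedNbr_image_union (by simp [hp]), huniv] at hlt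
      have hcard := h.card_image_union (subset_closedNbr (G.comap f) S hp) (mem_univ q)
      rw [card_fin] at hcard
      have hsum := h.sum_image_union a hp (mem_univ q)
      have htot := h.sum_image_union a (mem_univ p) (mem_univ q)
      rw [h.image_univ_union, ha.1] at htot
      have := sum_normalizedRestrict_add f a hp
      have := h.card_add_one
      omega
    · have hlt := ha.2 (S.image f) (hS.image f)
      change _ < (closedNbr G _).card at hlt
      rw [h.closedNbr_image hp, card_image_of_injective _ h.injective_left,
        sum_image h.injective_left.injOn] at hlt
      refine (sum_congr rfl fun i hi => ?_).trans_lt hlt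
      have : i ≠ p := fun e => hp (e ▸ hi)
      simp [normalizedRestrict, this]

theorem glueSum_swap (x : (Fin m → ℕ) × (Fin k → ℕ)) : glueSum g f x.swap = glueSum f g x :=
  funext fun _ => add_comm _ _

theorem glueSum_apply_of_ne (h : IsVertexGluing G f g p q) (x : (Fin m → ℕ) × (Fin k → ℕ))
    {i : Fin m} (hi : i ≠ p) : glueSum f g x (f i) = x.1 i := by
  have h₁ : (univ.filter fun i' => f i' = f i) = {i} := by
    ext i'
    simp [h.injective_left.eq_iff]
  have h₂ : (univ.filter fun j => g j = f i) = ∅ :=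
    filter_eq_empty_iff.2 fun j _ e => hi (h.eq_of_apply_eq i j e.symm).1
  rw [glueSum, h₁, h₂]
  simp

theorem glueSum_apply_self (h : IsVertexGluing G f g p q) (x : (Fin m → ℕ) × (Fin k → ℕ)) :
    glueSum f g x (f p) = x.1 p + x.2 q := by
  have h₁ : (univ.filter fun i => f i = f p) = {p} := by
    ext i
    simp [h.injective_left.eq_iff]
  have h₂ : (univ.filter fun j => g j = f p) = {q} := by
    ext j
    simp [h.apply_eq, h.injective_right.eq_iff]
  rw [glueSum, h₁, h₂]
  simp

theorem glueSum_normalizedRestrict (h : IsVertexGluing G f g p q) (hm : 1 < m) (hk : 1 < k)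
    {a : Fin N → ℕ} (ha : draconian G a) :
    glueSum f g (normalizedRestrict f p a, normalizedRestrict g q a) = a := by
  have hf : ∀ i, i ≠ p →
      glueSum f g (normalizedRestrict f p a, normalizedRestrict g q a) (f i) = a (f i) := by
    intro i hi
    rw [h.glueSum_apply_of_ne _ hi]
    simp [normalizedRestrict, hi]
  have hr : glueSum f g (normalizedRestrict f p a, normalizedRestrict g q a) (f p) = a (f p) := by
    rw [h.glueSum_apply_self]
    have h₁ := h.normalizedRestrict_self_add hm ha
    have h₂ := h.symm.normalizedRestrict_self_add hk ha
    have htot := h.sum_image_union a (mem_univ p) (mem_univ q)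
    rw [h.image_univ_union, ha.1] at htot
    rw [← h.apply_eq] at h₂
    have := h.card_add_one
    dsimp only
    omega
  funext v
  obtain ⟨i, rfl⟩ | ⟨j, rfl⟩ := h.cover v
  · by_cases hi : i = p
    · rw [hi, hr]
    · exact hf i hi
  · by_cases hj : j = q
    · rw [hj, ← h.apply_eq, hr]
    · rw [← glueSum_swap, h.symm.glueSum_apply_of_ne _ hj]
      simp [normalizedRestrict, hj]

theorem fst_eq_of_glueSum_eq (h : IsVertexGluing G f g p q)
    {x y : (Fin m → ℕ) × (Fin k → ℕ)} (hxy : glueSum f g x = glueSum f g y)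
    (hsum : ∑ i, x.1 i = ∑ i, y.1 i) : x.1 = y.1 := by
  have hne : ∀ i, i ≠ p → x.1 i = y.1 i := fun i hi => by
    rw [← h.glueSum_apply_of_ne x hi, hxy, h.glueSum_apply_of_ne y hi]
  funext i
  by_cases hi : i = p
  · subst hi
    rw [← add_sum_erase _ _ (mem_univ i), ← add_sum_erase _ y.1 (mem_univ i),
      sum_congr rfl fun j hj => hne j (ne_of_mem_erase hj)] at hsum
    exact Nat.add_right_cancel hsum
  · exact hne i hi

theorem ncard_draconian (h : IsVertexGluing G f g p q) (hm : 1 < m) (hk : 1 < k) :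
    {a | draconian G a}.ncard =
      {b | draconian (G.comap f) b}.ncard * {c | draconian (G.comap g) c}.ncard := by
  have himage : {a | draconian G a} =
      glueSum f g '' ({b | draconian (G.comap f) b} ×ˢ {c | draconian (G.comap g) c}) := by
    ext a
    constructor
    · intro ha
      exact ⟨(_, _), ⟨h.draconian_normalizedRestrict hm ha, h.symm.draconian_normalizedRestrict hk ha⟩,
        h.glueSum_normalizedRestrict hm hk ha⟩
    · rintro ⟨x, ⟨hb, hc⟩, rfl⟩
      exact h.draconian_glueSum hb hc
  rw [himage, Set.InjOn.ncard_image, Set.ncard_prod]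
  rintro x ⟨hx₁, hx₂⟩ y ⟨hy₁, hy₂⟩ hxy
  refine Prod.ext (h.fst_eq_of_glueSum_eq hxy (hx₁.1.trans hy₁.1.symm)) ?_
  refine h.symm.fst_eq_of_glueSum_eq (x := x.swap) (y := y.swap) ?_ (hx₂.1.trans hy₂.1.symm)
  rw [glueSum_swap, glueSum_swap, hxy]

end IsVertexGluing

/-- Cut-vertex product formula. Let `G` be connected on `[N]` with `1 < M < N`, and suppose
every edge of `G` has both endpoints in `[M]` or both endpoints in `{1} ∪ {M+1, …, N}`
(here `0`-indexed: both in `{0, …, M-1}`, or both in `{0} ∪ {M, …, N-1}`), so vertex `1` is a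
cut-vertex separating `B = G[[M]]` from `B' = G[{1, M+1, …, N}]`. Regarding `B` as a graph on
`[M]` and `B'` as a graph on `[N-M+1]` via the order-preserving relabeling `1 ↦ 1`,
`M+i ↦ i+1`, we have `|𝔇(G)| = |𝔇(B)| · |𝔇(B')|`. -/
theorem ncard_draconian_cut_vertex {N M : ℕ} (hM : 1 < M) (hMN : M < N)
    (G : SimpleGraph (Fin N)) (hconn : G.Connected)
    (hsplit : ∀ i j : Fin N, G.Adj i j →
      ((i : ℕ) < M ∧ (j : ℕ) < M) ∨
        (((i : ℕ) = 0 ∨ M ≤ (i : ℕ)) ∧ ((j : ℕ) = 0 ∨ M ≤ (j : ℕ)))) :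
    {a : Fin N → ℕ | draconian G a}.ncard =
      {a : Fin M → ℕ | draconian (G.comap (Fin.castLE hMN.le)) a}.ncard *
      {a : Fin (N - M + 1) → ℕ |
        draconian
          (G.comap (fun j : Fin (N - M + 1) =>
            (⟨if (j : ℕ) = 0 then 0 else M + (j : ℕ) - 1, by
                have := j.isLt; split <;> omega⟩ : Fin N)))
          a}.ncard := by
  refine IsVertexGluing.ncard_draconian (p := ⟨0, by omega⟩) (q := ⟨0, by omega⟩)
    ?_ hM (by omega)
  have hleft : ∀ v : Fin N, (v : ℕ) < M → ∃ i, Fin.castLE hMN.le i = v :=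
    fun v hv => ⟨⟨v, hv⟩, rfl⟩
  have hright : ∀ v : Fin N, (v : ℕ) = 0 ∨ M ≤ (v : ℕ) → ∃ j : Fin (N - M + 1),
      (⟨if (j : ℕ) = 0 then 0 else M + (j : ℕ) - 1, by
        have := j.isLt; split <;> omega⟩ : Fin N) = v := by
    intro v hv
    have := v.isLt
    refine ⟨⟨if (v : ℕ) = 0 then 0 else v - M + 1, by split <;> omega⟩, Fin.ext ?_⟩
    by_cases h0 : (v : ℕ) = 0
    · simp [h0]
    · simp only [h0, if_false, Nat.add_one_ne_zero]
      omega
  refine ⟨Fin.castLE_injective _, ?_, ?_, ?_, ?_, ?_⟩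
  · intro i j hij
    simp only [Fin.mk.injEq] at hij
    apply Fin.ext
    split_ifs at hij <;> omega
  · simp
  · intro i j hij
    have := i.isLt
    simp only [Fin.ext_iff, Fin.val_castLE] at hij ⊢
    split_ifs at hij <;> omega
  · intro v
    rcases lt_or_ge (v : ℕ) M with hv | hv
    exacts [.inl (hleft v hv), .inr (hright v (.inr hv))]
  · intro u v huv
    exact (hsplit u v huv).imp (.imp (hleft u) (hleft v)) (.imp (hright u) (hright v))
end

section
/- Let G be a connected simple graph on [N] with an edge e = uv such that deg_G(u) = 2. If (c_1,…,c_N) is a D(G)-draconian sequence, then (c_1,…,c_N,1) is a D(G:e)-draconian sequence. Moreover, the map c ↦ (c,1) is an injection from 𝔇(G) into 𝔇(G:e). -/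
open Finset

attribute [local instance] Classical.propDecidable

/-- The subdivision `G : e` of the edge `e = uv` of `G`: the graph on `[N+1]` with edge
set `(E(G) ∖ {uv}) ∪ {u(N+1), v(N+1)}`. -/
def subdiv {N : ℕ} (G : SimpleGraph (Fin N)) (u v : Fin N) : SimpleGraph (Fin (N + 1)) :=
  SimpleGraph.fromRel (fun i j =>
    (∃ a b : Fin N, i = a.castSucc ∧ j = b.castSucc ∧ G.Adj a b ∧
      ¬(a = u ∧ b = v) ∧ ¬(a = v ∧ b = u))
    ∨ (i = u.castSucc ∧ j = Fin.last N) ∨ (i = v.castSucc ∧ j = Fin.last N))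

/-- The graph `G △ e` for an edge `e = uv` of `G`: the graph on `[N+1]` with edge set
`E(G) ∪ {u(N+1), v(N+1)}`. -/
def triExt {N : ℕ} (G : SimpleGraph (Fin N)) (u v : Fin N) : SimpleGraph (Fin (N + 1)) :=
  SimpleGraph.fromRel (fun i j =>
    (∃ a b : Fin N, i = a.castSucc ∧ j = b.castSucc ∧ G.Adj a b)
    ∨ (i = u.castSucc ∧ j = Fin.last N) ∨ (i = v.castSucc ∧ j = Fin.last N))

/-- A graph on `[N]` is `2`-connected if it has at least `3` vertices, is connected, and
remains connected after deleting any single vertex. -/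
def TwoConnected {N : ℕ} (G : SimpleGraph (Fin N)) : Prop :=
  3 ≤ N ∧ G.Connected ∧
    ∀ v : Fin N, (G.comap (fun u : {w : Fin N // w ≠ v} => (u : Fin N))).Connected

theorem mem_union_biUnion_nbr {N : ℕ} (G : SimpleGraph (Fin N)) (S : Finset (Fin N))
    (j : Fin N) :
    j ∈ S ∪ S.biUnion (fun i => nbr G i) ↔ j ∈ S ∨ ∃ i ∈ S, G.Adj i j := by
  simp [nbr]

theorem subdiv_adj_castSucc {N : ℕ} (G : SimpleGraph (Fin N)) (u v a b : Fin N) :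
    (subdiv G u v).Adj a.castSucc b.castSucc ↔
      G.Adj a b ∧ ¬(a = u ∧ b = v) ∧ ¬(a = v ∧ b = u) := by
  have hne := fun i : Fin N => Fin.castSucc_ne_last i
  simp only [subdiv, SimpleGraph.fromRel_adj, Fin.castSucc_inj, ne_eq, hne, and_false, or_false]
  constructor
  · rintro ⟨-, ⟨a', b', rfl, rfl, h⟩ | ⟨a', b', rfl, rfl, h⟩⟩
    · exact h
    · exact ⟨h.1.symm, by tauto⟩
  · intro h
    exact ⟨h.1.ne, Or.inl ⟨a, b, rfl, rfl, h⟩⟩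

theorem subdiv_adj_last {N : ℕ} (G : SimpleGraph (Fin N)) (u v a : Fin N) :
    (subdiv G u v).Adj a.castSucc (Fin.last N) ↔ a = u ∨ a = v := by
  have hne := fun i : Fin N => Fin.castSucc_ne_last i
  have hne' := fun i : Fin N => (Fin.castSucc_ne_last i).symm
  simp [subdiv, SimpleGraph.fromRel_adj, hne, hne']

theorem sum_eq_sum_castSucc_add {N : ℕ} (S : Finset (Fin (N + 1))) (f : Fin (N + 1) → ℕ) :
    ∑ i ∈ S, f i = ∑ i ∈ univ.filter (fun i : Fin N => i.castSucc ∈ S), f i.castSucc +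
      if Fin.last N ∈ S then f (Fin.last N) else 0 := by
  rw [Finset.sum_filter, ← Fin.sum_univ_castSucc (fun i => if i ∈ S then f i else 0),
    Finset.sum_ite_mem, Finset.univ_inter]

/-- Subdividing an edge never shrinks closed neighborhoods, and enlarges those of sets to which
the new vertex is added. -/
theorem card_closedNbr_add_le_card_closedNbr_subdiv {N : ℕ} (G : SimpleGraph (Fin N))
    (u v : Fin N) (S : Finset (Fin (N + 1))) (T : Finset (Fin N))
    (hT : ∀ i, i ∈ T ↔ i.castSucc ∈ S) :
    (T ∪ T.biUnion (fun i => nbr G i)).card + (if Fin.last N ∈ S then 1 else 0) ≤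
      (S ∪ S.biUnion (fun i => nbr (subdiv G u v) i)).card := by
  set A := S ∪ S.biUnion (fun i => nbr (subdiv G u v) i) with hA
  set C := T ∪ T.biUnion (fun i => nbr G i) with hC
  set B := univ.filter (fun i : Fin N => i.castSucc ∈ A) with hB
  have card_A : A.card = B.card + if Fin.last N ∈ A then 1 else 0 := by
    simpa using sum_eq_sum_castSucc_add A (fun _ => 1)
  have last_mem (h : Fin.last N ∈ S ∨ u ∈ T ∨ v ∈ T) : Fin.last N ∈ A := by
    rw [hA, mem_union_biUnion_nbr]
    rcases h with h | h | h
    · exact Or.inl h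
    · exact Or.inr ⟨_, (hT u).1 h, (subdiv_adj_last G u v u).2 (Or.inl rfl)⟩
    · exact Or.inr ⟨_, (hT v).1 h, (subdiv_adj_last G u v v).2 (Or.inr rfl)⟩
  have mem_B (j : Fin N) (hj : j ∈ C) (h : j = v → u ∈ T → v ∈ T ∨ Fin.last N ∈ S)
      (h' : j = u → v ∈ T → u ∈ T ∨ Fin.last N ∈ S) : j ∈ B := by
    rw [hB, mem_filter, hA, mem_union_biUnion_nbr]
    refine ⟨mem_univ _, ?_⟩
    rw [hC, mem_union_biUnion_nbr] at hj
    rcases hj with hj | ⟨i, hi, hij⟩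
    · exact Or.inl ((hT j).1 hj)
    have key (hj : j = u ∨ j = v) (hS : j ∈ T ∨ Fin.last N ∈ S) : j.castSucc ∈ S ∨
        ∃ i ∈ S, (subdiv G u v).Adj i j.castSucc :=
      hS.imp (hT j).1 fun hS => ⟨_, hS, ((subdiv_adj_last G u v j).2 hj).symm⟩
    by_cases h1 : i = u ∧ j = v
    · obtain ⟨rfl, rfl⟩ := h1
      exact key (Or.inr rfl) (h rfl hi)
    by_cases h2 : i = v ∧ j = u
    · obtain ⟨rfl, rfl⟩ := h2
      exact key (Or.inl rfl) (h' rfl hi)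
    exact Or.inr ⟨_, (hT i).1 hi, (subdiv_adj_castSucc G u v i j).2 ⟨hij, h1, h2⟩⟩
  rw [card_A]
  by_cases hS : Fin.last N ∈ S
  · rw [if_pos hS, if_pos (last_mem (Or.inl hS))]
    gcongr
    exact fun j hj => mem_B j hj (fun _ _ => Or.inr hS) (fun _ _ => Or.inr hS)
  rw [if_neg hS, add_zero]
  by_cases huv : u ∈ T ↔ v ∈ T
  · exact (card_le_card fun j hj => mem_B j hj (fun _ h => Or.inl (huv.1 h))
      (fun _ h => Or.inl (huv.2 h))).trans (Nat.le_add_right _ _)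
  rw [if_pos (last_mem (by tauto)), ← Nat.sub_le_iff_le_add]
  by_cases hu : u ∈ T
  · refine pred_card_le_card_erase.trans (card_le_card (s := C.erase v) fun j hj => ?_)
    rw [mem_erase] at hj
    exact mem_B j hj.2 (fun h => absurd h hj.1) (fun _ _ => Or.inl hu)
  · refine pred_card_le_card_erase.trans (card_le_card (s := C.erase u) fun j hj => ?_)
    rw [mem_erase] at hj
    exact mem_B j hj.2 (fun _ h => absurd h hu) (fun h => absurd h hj.1)

/-- Let `G` be a connected graph on `[N]` with an edge `e = uv` such that `deg_G(u) = 2`.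
If `c` is `D(G)`-draconian, then `(c, 1)` is `D(G : e)`-draconian; moreover, `c ↦ (c, 1)`
is an injection from `𝔇(G)` into `𝔇(G : e)`. -/
theorem draconian_snoc_one_subdiv {N : ℕ} (G : SimpleGraph (Fin N)) (hconn : G.Connected)
    (u v : Fin N) (he : G.Adj u v) (hdeg : (nbr G u).card = 2) :
    (∀ c : Fin N → ℕ, draconian G c → draconian (subdiv G u v) (Fin.snoc c 1)) ∧
    Set.InjOn (fun c : Fin N → ℕ => (Fin.snoc c 1 : Fin (N + 1) → ℕ))
      {a | draconian G a} := by
  refine ⟨fun c hc => ⟨?_, fun S hS => ?_⟩, fun a _ b _ hab => ?_⟩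
  · have hN : 0 < N := u.pos
    rw [Fin.sum_univ_castSucc]
    simp only [Fin.snoc_castSucc, Fin.snoc_last, hc.1]
    omega
  · set T := univ.filter (fun i : Fin N => i.castSucc ∈ S) with hT
    have hTS (i : Fin N) : i ∈ T ↔ i.castSucc ∈ S := by simp [hT]
    rw [sum_eq_sum_castSucc_add]
    simp only [Fin.snoc_castSucc, Fin.snoc_last]
    rcases T.eq_empty_or_nonempty with hT0 | hT0
    · have hlast : Fin.last N ∈ S := by
        obtain ⟨i, hi⟩ := hS
        induction i using Fin.lastCases with
        | last => exact hi
        | cast i => simp [← hTS, hT0] at hi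
      rw [← hT, hT0, sum_empty, zero_add, if_pos hlast, one_lt_card]
      refine ⟨Fin.last N, ?_, u.castSucc, ?_, (Fin.castSucc_ne_last u).symm⟩
      · exact mem_union_left _ hlast
      · rw [mem_union_biUnion_nbr]
        exact Or.inr ⟨_, hlast, ((subdiv_adj_last G u v u).2 (Or.inl rfl)).symm⟩
    · exact (Nat.add_lt_add_right (hc.2 T hT0) _).trans_le
        (card_closedNbr_add_le_card_closedNbr_subdiv G u v S T hTS)
  · exact (Fin.snoc_injective2 hab).1
end
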